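/- Let 𝔹 be the unit disc in ℝ². Assume {v_ε}_{ε>0} is a family of functions in W_0^{1,2}(𝔹) with ∫_𝔹 |∇v_ε|² dx = 1 for every ε, and assume that the measures |∇v_ε|² dx converge weakly to the Dirac measure δ_0 at the origin as ε → 0. Then limsup_{ε→0} ∫_𝔹 (e^{4π v_ε²} − 1) dx ≤ π e. -/

import Mathlib

/-!
Carleson–Chang's lemma on the unit disc `𝔹 ⊂ ℝ²`. Mathlib has no Sobolev
space `W₀^{1,2}(𝔹)`, so membership of `v ε` in `W₀^{1,2}(𝔹)` is encoded by:
`v ε` is differentiable and vanishes outside the open unit ball. Gradients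
are expressed through the Fréchet derivative, and weak convergence of the
energy measures `|∇v_ε|² dx` to the Dirac measure `δ₀` is expressed by
convergence against continuous test functions.
-/

open MeasureTheory Real Filter Metric
open scoped ENNReal Topology

noncomputable section

local notation "E" => EuclideanSpace ℝ (Fin 2)

/-- Subdivision principle: a function with uniformly `o(h)` increments from above is nonincreasing. -/
lemma cc_sub_le (Q : ℝ → ℝ) (a b : ℝ) (hab : a ≤ b)
    (h : ∀ ε > 0, ∃ δ > 0, ∀ s t, a ≤ s → s ≤ t → t ≤ b → t - s < δ → Q t - Q s ≤ ε * (t - s)) :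
    Q b ≤ Q a := by
  have key : ∀ ε > 0, Q b - Q a ≤ ε * (b - a) := by
    intro ε hε
    obtain ⟨δ, hδ, H⟩ := h ε hε
    obtain ⟨n, hn⟩ := exists_nat_gt ((b - a) / δ)
    have hn0 : (0 : ℝ) < n := lt_of_le_of_lt (div_nonneg (by linarith) hδ.le) hn
    have hnδ : (b - a) / n < δ := by
      rw [div_lt_iff₀ hδ] at hn
      rw [div_lt_iff₀ hn0]; linarith
    have hs := Finset.sum_range_sub (fun i : ℕ => Q (a + i * ((b - a) / n))) n
    have e1 : a + (n : ℝ) * ((b - a) / n) = b := by field_simp; ring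
    simp only [e1] at hs
    simp only [Nat.cast_zero, zero_mul, add_zero] at hs
    rw [← hs]
    have hd : 0 ≤ (b - a) / n := div_nonneg (by linarith) hn0.le
    calc _ ≤ ∑ i ∈ Finset.range n, ε * ((b - a) / n) := by
          apply Finset.sum_le_sum
          intro i hi
          have hi' : (i : ℝ) + 1 ≤ n := by exact_mod_cast Finset.mem_range.1 hi
          have hi0 : (0 : ℝ) ≤ i := Nat.cast_nonneg i
          have := H (a + i * ((b - a) / n)) (a + ((i + 1 : ℕ) : ℝ) * ((b - a) / n))
            (by nlinarith) (by push_cast; nlinarith)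
            (by
              push_cast
              calc _ ≤ a + (n : ℝ) * ((b - a) / n) := by gcongr
                _ = b := e1)
            (by
              have e : a + ((i + 1 : ℕ) : ℝ) * ((b - a) / n) - (a + i * ((b - a) / n)) = (b - a) / n := by
                push_cast; ring
              rw [e]; exact hnδ)
          calc _ ≤ _ := this
            _ = _ := by push_cast; ring
      _ = ε * (b - a) := by
          rw [Finset.sum_const, Finset.card_range, nsmul_eq_mul]; field_simp
  by_contra hc
  push Not at hc
  have hba : 0 ≤ b - a := by linarith
  have := key ((Q b - Q a) / (2 * (b - a + 1))) (by apply div_pos <;> linarith)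
  rw [div_mul_eq_mul_div, le_div_iff₀ (by linarith)] at this
  nlinarith

lemma cc_holder_cont (Y F : ℝ → ℝ) (hF : Monotone F)
    (hY : ∀ s t, s ≤ t → (Y t - Y s) ^ 2 ≤ (F t - F s) * (t - s)) : Continuous Y := by
  rw [Metric.continuous_iff]
  intro b ε hε
  set C := F (b + 1) - F (b - 1) + 1 with hC
  have hC1 : 1 ≤ C := by have := hF (show b - 1 ≤ b + 1 by linarith); linarith
  refine ⟨min 1 (ε ^ 2 / C), by positivity, ?_⟩
  intro t ht
  rw [Real.dist_eq] at ht ⊢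
  obtain ⟨h1, h2⟩ := lt_min_iff.1 ht
  have h3 := abs_lt.1 h1
  rw [lt_div_iff₀ (by linarith)] at h2
  apply abs_lt_of_sq_lt_sq _ hε.le
  rcases le_total t b with h | h
  · have := hY t b h
    rw [abs_of_nonpos (by linarith)] at h2
    have f1 := hF (show b - 1 ≤ t by linarith)
    have f2 := hF (show b ≤ b + 1 by linarith)
    nlinarith
  · have := hY b t h
    rw [abs_of_nonneg (by linarith)] at h2
    have f1 := hF (show b - 1 ≤ b by linarith)
    have f2 := hF (show t ≤ b + 1 by linarith)
    nlinarith

/-- The one-dimensional Onofri type inequality, by calibration. -/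
lemma cc_cal (Y F : ℝ → ℝ) (hF : Monotone F) (h0 : Y 0 = 0)
    (hY : ∀ s t, s ≤ t → (Y t - Y s) ^ 2 ≤ (F t - F s) * (t - s)) (R : ℝ) (hR : 0 ≤ R) :
    ∫ t in (0 : ℝ)..R, Real.exp (Y t - t) ≤ Real.exp (1 + (F R - F 0) / 4) := by
  have hc : Continuous Y := cc_holder_cont Y F hF hY
  set J : ℝ → ℝ := fun t => ∫ s in (0 : ℝ)..t, Real.exp (Y s - s) with hJ
  have hInteg : Continuous fun s => Real.exp (Y s - s) := by fun_prop
  have hJd : ∀ t, HasDerivAt J (Real.exp (Y t - t)) t := fun t =>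
    intervalIntegral.integral_hasDerivAt_right (hInteg.intervalIntegrable _ _)
      (hInteg.stronglyMeasurableAtFilter _ _) hInteg.continuousAt
  have hJc : Continuous J := continuous_iff_continuousAt.2 fun t => (hJd t).continuousAt
  have hJmono : Monotone J := monotone_of_hasDerivAt_nonneg hJd (fun t => (Real.exp_pos _).le)
  -- exact bound on z
  have hz : ∀ t, 0 ≤ t → Y t - t ≤ (F t - F 0) / 4 := by
    intro t ht
    have h1 := hY 0 t ht
    have h2 := hF ht
    rw [h0] at h1
    nlinarith [sq_nonneg (t - (F t - F 0) / 4), abs_le_of_sq_le_sq (show (Y t) ^ 2 ≤ (t + (F t - F 0) / 4) ^ 2 by nlinarith [sq_nonneg (t - (F t - F 0) / 4)]) (by linarith), le_abs_self (Y t)]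
  change J R ≤ _
  rcases le_or_gt (J R) (Real.exp (Y R - R)) with hcase | hcase
  · refine hcase.trans (Real.exp_le_exp.2 ?_)
    have := hz R hR; linarith
  · obtain ⟨T, ⟨hT0, hTR⟩, hT⟩ : ∃ T ∈ Set.Icc 0 R, J T - Real.exp (Y T - T) = 0 := by
      apply intermediate_value_Icc hR (f := fun t => J t - Real.exp (Y t - t))
      · exact (hJc.sub hInteg).continuousOn
      · constructor
        · simp [hJ]; exact (Real.exp_pos _).le
        · linarith
    have hJT : J T = Real.exp (Y T - T) := by linarith
    have hJpos : ∀ t, T ≤ t → 0 < J t := fun t ht =>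
      lt_of_lt_of_le (hJT ▸ Real.exp_pos _) (hJmono ht)
    set q : ℝ → ℝ := fun t => Real.exp (Y t - t) / J t with hq
    have hqc : ContinuousOn q (Set.Icc T R) :=
      hInteg.continuousOn.div hJc.continuousOn (fun t ht => (hJpos t ht.1).ne')
    have hmain : (fun t => Real.log (J t) + q t - F t / 4) R ≤
        (fun t => Real.log (J t) + q t - F t / 4) T := by
      apply cc_sub_le _ T R hTR
      intro ε hε
      set H : ℝ × ℝ × ℝ → ℝ := fun z => q z.2.2 ^ 2 + q z.2.1 -
        Real.exp (Y z.1 - Y z.2.1) * q z.2.1 * (1 + q z.2.1) with hH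
      have hHc : ContinuousOn H (Set.Icc T R ×ˢ (Set.Icc T R ×ˢ Set.Icc T R)) := by
        have c1 : ContinuousOn (fun z : ℝ × ℝ × ℝ => q z.2.2)
          (Set.Icc T R ×ˢ (Set.Icc T R ×ˢ Set.Icc T R)) :=
            hqc.comp (by fun_prop) (fun z hz => hz.2.2)
        have c2 : ContinuousOn (fun z : ℝ × ℝ × ℝ => q z.2.1)
          (Set.Icc T R ×ˢ (Set.Icc T R ×ˢ Set.Icc T R)) :=
            hqc.comp (by fun_prop) (fun z hz => hz.2.1)
        have c3 : Continuous (fun z : ℝ × ℝ × ℝ => Real.exp (Y z.1 - Y z.2.1)) := by fun_prop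
        exact ((c1.pow 2).add c2).sub ((c3.continuousOn.mul c2).mul (continuousOn_const.add c2))
      have hcomp : IsCompact (Set.Icc T R ×ˢ (Set.Icc T R ×ˢ Set.Icc T R)) :=
        isCompact_Icc.prod (isCompact_Icc.prod isCompact_Icc)
      have hu := hcomp.uniformContinuousOn_of_continuous hHc
      obtain ⟨δ, hδ, Hδ⟩ := Metric.uniformContinuousOn_iff.1 hu ε hε
      refine ⟨δ, hδ, ?_⟩
      intro s t hs hst htR htδ
      rcases eq_or_lt_of_le hst with rfl | hst'
      · simp
      have hdiff : ∀ u, T ≤ u → HasDerivAt (fun u => Real.log (J u) + Real.exp (Y s) * (Real.exp (-u) / J u))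
          (q u - Real.exp (Y s - Y u) * q u * (1 + q u)) u := by
        intro u hu
        have hJu := hJpos u hu
        have d1 := (hJd u).log hJu.ne'
        have d2 : HasDerivAt (fun u : ℝ => Real.exp (-u)) (-Real.exp (-u)) u := by
          simpa using (hasDerivAt_neg u).exp
        have d3 := (d2.div (hJd u) hJu.ne').const_mul (Real.exp (Y s))
        refine (d1.add d3).congr_deriv ?_
        simp only [hq]
        have e1 : Real.exp (Y s - Y u) = Real.exp (Y s) / Real.exp (Y u) := Real.exp_sub _ _
        have e2 : Real.exp (Y u - u) = Real.exp (Y u) * Real.exp (-u) := by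
          rw [← Real.exp_add]; ring_nf
        rw [e1, e2]
        have := (Real.exp_pos (Y u)).ne'
        field_simp
        ring
      obtain ⟨ξ, hξ, hξe⟩ := exists_hasDerivAt_eq_slope (fun u => Real.log (J u) + Real.exp (Y s) * (Real.exp (-u) / J u))
        (fun u => q u - Real.exp (Y s - Y u) * q u * (1 + q u)) hst'
        (fun u hu => (hdiff u (hs.trans hu.1)).continuousAt.continuousWithinAt)
        (fun u hu => hdiff u (hs.trans hu.1.le))
      rw [eq_div_iff (by linarith)] at hξe
      have hqt : ∀ u, q u = Real.exp (Y u) * (Real.exp (-u) / J u) := by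
        intro u
        simp only [hq]
        rw [← mul_div_assoc, ← Real.exp_add, sub_eq_add_neg]
      have hJt := hJpos t (hs.trans hst)
      have hk : 0 < Real.exp (-t) / J t := div_pos (Real.exp_pos _) hJt
      -- jump part
      have hj : (Real.exp (Y t) - Real.exp (Y s)) * (Real.exp (-t) / J t) ≤
          q t ^ 2 * (t - s) + (F t - F s) / 4 := by
        have a1 : Real.exp (Y t) - Real.exp (Y s) ≤ Real.exp (Y t) * (Y t - Y s) := by
          have := Real.add_one_le_exp (Y s - Y t)
          have e1 : Real.exp (Y s) = Real.exp (Y t) * Real.exp (Y s - Y t) := by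
            rw [← Real.exp_add]; ring_nf
          rw [e1]
          nlinarith [Real.exp_pos (Y t)]
        have a2 : (Real.exp (Y t) - Real.exp (Y s)) * (Real.exp (-t) / J t) ≤ q t * (Y t - Y s) := by
          rw [hqt]; nlinarith
        have a3 : q t * (Y t - Y s) ≤ q t ^ 2 * (t - s) + (F t - F s) / 4 := by
          have h1 := hY s t hst
          have h2 := hF hst
          have hqp : 0 ≤ q t := by rw [hqt]; positivity
          have h3 : (q t * (Y t - Y s)) ^ 2 ≤ (q t ^ 2 * (t - s) + (F t - F s) / 4) ^ 2 := by
            have : (q t) ^ 2 * (Y t - Y s) ^ 2 ≤ (q t) ^ 2 * ((F t - F s) * (t - s)) := by gcongr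
            nlinarith [sq_nonneg (q t ^ 2 * (t - s) - (F t - F s) / 4)]
          exact (le_abs_self _).trans (abs_le_of_sq_le_sq h3 (by
            have : 0 ≤ t - s := by linarith
            have : 0 ≤ F t - F s := by linarith
            positivity))
        linarith
      have hsm : H (s, ξ, t) ≤ ε := by
        have m1 : s ∈ Set.Icc T R := ⟨hs, hst.trans htR⟩
        have m2 : ξ ∈ Set.Icc T R := ⟨hs.trans hξ.1.le, hξ.2.le.trans htR⟩
        have m3 : t ∈ Set.Icc T R := ⟨hs.trans hst, htR⟩
        have := Hδ (s, ξ, t) ⟨m1, m2, m3⟩ (s, s, s) ⟨m1, m1, m1⟩ (by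
          rw [Prod.dist_eq, Prod.dist_eq]
          simp only [dist_self, Real.dist_eq]
          rw [abs_of_pos (by linarith [hξ.1]), abs_of_pos (by linarith)]
          simp only [max_lt_iff]
          exact ⟨hδ, by linarith [hξ.2], htδ⟩)
        have z : H (s, s, s) = 0 := by simp only [hH]; simp; ring
        rw [z, Real.dist_eq, sub_zero] at this
        exact (le_abs_self _).trans this.le
      have : H (s, ξ, t) * (t - s) ≤ ε * (t - s) := by
        apply mul_le_mul_of_nonneg_right hsm; linarith
      simp only [hH] at this
      have e3 := hqt t
      have e4 := hqt s
      nlinarith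
    simp only at hmain
    have hqT : q T = 1 := by
      simp only [hq]; rw [hJT]; exact div_self (Real.exp_pos _).ne'
    have hqR : 0 ≤ q R := div_nonneg (Real.exp_pos _).le (hJpos R hTR).le
    have hlT : Real.log (J T) = Y T - T := by rw [hJT, Real.log_exp]
    have := hz T hT0
    rw [← Real.log_le_iff_le_exp (hJpos R hTR)]
    linarith


lemma cc_refine (w F : ℝ → ℝ)
    (hF : Monotone F)
    (h : ∀ s t, s ≤ t → (w t - w s) ^ 2 ≤ (F t - F s) * (Real.exp (t - s) - 1)) :
    ∀ s t, s ≤ t → (w t - w s) ^ 2 ≤ (F t - F s) * (t - s) := by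
  intro s t hst
  have key : ∀ n : ℕ, 0 < n →
      (w t - w s) ^ 2 ≤ (F t - F s) * ((t - s) * Real.exp ((t - s) / n)) := by
    intro n hn
    have hn0 : (0 : ℝ) < n := by exact_mod_cast hn
    set d := (t - s) / n with hd
    have hd0 : 0 ≤ d := div_nonneg (by linarith) hn0.le
    have e1 : s + (n : ℝ) * d = t := by rw [hd]; field_simp; ring
    have hw := Finset.sum_range_sub (fun i : ℕ => w (s + i * d)) n
    have hf := Finset.sum_range_sub (fun i : ℕ => F (s + i * d)) n
    simp only [e1, Nat.cast_zero, zero_mul, add_zero] at hw hf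
    have hstep : ∀ i : ℕ, s + ((i + 1 : ℕ) : ℝ) * d - (s + i * d) = d := by
      intro i; push_cast; ring
    have hle : ∀ i : ℕ, s + i * d ≤ s + ((i + 1 : ℕ) : ℝ) * d := by
      intro i; have := hstep i; linarith
    have hexp : Real.exp d - 1 ≤ d * Real.exp d := by
      have := Real.add_one_le_exp (-d)
      have h2 : Real.exp d * Real.exp (-d) = 1 := by rw [← Real.exp_add]; simp
      nlinarith [Real.exp_pos d]
    have hcs := sq_sum_le_card_mul_sum_sq (s := Finset.range n)
      (f := fun i : ℕ => w (s + ((i + 1 : ℕ) : ℝ) * d) - w (s + i * d))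
    rw [hw, Finset.card_range] at hcs
    calc (w t - w s) ^ 2 ≤ _ := hcs
      _ ≤ n * ∑ i ∈ Finset.range n, (F (s + ((i + 1 : ℕ) : ℝ) * d) - F (s + i * d)) * (d * Real.exp d) := by
          gcongr with i hi
          refine (h _ _ (hle i)).trans ?_
          rw [hstep i]
          apply mul_le_mul_of_nonneg_left hexp
          have := hF (hle i); linarith
      _ = (F t - F s) * ((n * d) * Real.exp d) := by
          rw [← Finset.sum_mul, hf]; ring
      _ = _ := by
          congr 2; rw [hd]; field_simp
  have hlim : Tendsto (fun n : ℕ => (F t - F s) * ((t - s) * Real.exp ((t - s) / n))) atTop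
      (𝓝 ((F t - F s) * ((t - s) * Real.exp 0))) := by
    apply Tendsto.const_mul
    apply Tendsto.const_mul
    exact (Real.continuous_exp.tendsto 0).comp (tendsto_const_div_atTop_nhds_zero_nat (t - s))
  rw [Real.exp_zero, mul_one] at hlim
  apply ge_of_tendsto hlim
  filter_upwards [eventually_gt_atTop 0] with n hn using key n hn

lemma cc_tail (w F : ℝ → ℝ) (hF : Monotone F) (hF1 : ∀ t, F t ≤ 1)
    (hw : Monotone w)
    (h : ∀ s t, s ≤ t → (w t - w s) ^ 2 ≤ (F t - F s) * (t - s)) (a : ℝ)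
    (hwa : 0 ≤ w a) (hl : 0 < F a) (hA : w a ^ 2 ≤ F a * a) :
    ∫⁻ t in Set.Ioi a, ENNReal.ofReal (Real.exp (w t ^ 2 - t)) ≤
      ENNReal.ofReal (Real.exp 1 / F a) := by
  have hwc : Continuous w := cc_holder_cont w F hF h
  have hfc : Continuous fun t => Real.exp (w t ^ 2 - t) := by fun_prop
  set l := F a with hldef
  set A := w a with hAdef
  have hb : ∀ R, a ≤ R → ∫ t in a..R, Real.exp (w t ^ 2 - t) ≤ Real.exp 1 / l := by
    intro R hR
    have hcal := cc_cal (fun t => 2 * A * (w (a + t / l) - A)) (fun t => 4 * A ^ 2 * F (a + t / l) / l)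
      (by
        intro x y hxy
        have : F (a + x / l) ≤ F (a + y / l) := hF (by gcongr)
        simp only
        gcongr)
      (by simp [hAdef])
      (by
        intro x y hxy
        have h1 := h (a + x / l) (a + y / l) (by gcongr)
        calc _ = 4 * A ^ 2 * (w (a + y / l) - w (a + x / l)) ^ 2 := by ring
          _ ≤ 4 * A ^ 2 * ((F (a + y / l) - F (a + x / l)) * (a + y / l - (a + x / l))) := by gcongr
          _ = _ := by ring)
      (l * (R - a)) (by apply mul_nonneg hl.le; linarith)
    have e1 : l * (R - a) / l = R - a := by field_simp
    simp only [e1, zero_div, add_zero] at hcal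
    rw [show a + (R - a) = R by ring] at hcal
    set g : ℝ → ℝ := fun s => Real.exp (2 * A * (w s - A) - l * (s - a)) with hg
    have hsub : ∫ t in (0:ℝ)..(l * (R - a)), Real.exp (2 * A * (w (a + t / l) - A) - t) =
        l * ∫ s in a..R, g s := by
      have := intervalIntegral.integral_comp_add_div (a := 0) (b := l * (R - a)) g hl.ne' a
      simp only [e1, zero_div, add_zero, smul_eq_mul] at this
      rw [show a + (R - a) = R by ring] at this
      rw [← this]
      apply intervalIntegral.integral_congr
      intro t _
      simp only [hg]
      congr 2
      field_simp; ring
    rw [hsub] at hcal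
    have hgc : Continuous g := by fun_prop
    have hpt : ∀ s ∈ Set.Icc a R, Real.exp (w s ^ 2 - s) ≤ Real.exp (A ^ 2 - a) * g s := by
      intro s hs
      simp only [hg]
      rw [← Real.exp_add, Real.exp_le_exp]
      have h1 := h a s hs.1
      have h2 := hF1 s
      have h3 : (F s - l) * (s - a) ≤ (1 - l) * (s - a) := by
        apply mul_le_mul_of_nonneg_right; linarith; linarith [hs.1]
      nlinarith
    have hgc2 : Continuous fun s => Real.exp (A ^ 2 - a) * g s := by fun_prop
    have hi := intervalIntegral.integral_mono_on (μ := volume) hR (hfc.intervalIntegrable _ _)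
      (hgc2.intervalIntegrable _ _) hpt
    rw [intervalIntegral.integral_const_mul] at hi
    refine hi.trans ?_
    rw [le_div_iff₀ hl]
    calc Real.exp (A ^ 2 - a) * (∫ s in a..R, g s) * l = Real.exp (A ^ 2 - a) * (l * ∫ s in a..R, g s) := by ring
      _ ≤ Real.exp (A ^ 2 - a) * Real.exp (1 + (4 * A ^ 2 * F R / l - 4 * A ^ 2 * F a / l) / 4) := by gcongr
      _ ≤ Real.exp 1 := by
        rw [← Real.exp_add, Real.exp_le_exp, ← hldef]
        have h5 : (4 * A ^ 2 * F R / l - 4 * A ^ 2 * l / l) / 4 ≤ A ^ 2 / l - A ^ 2 := by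
          have : 4 * A ^ 2 * F R / l ≤ 4 * A ^ 2 * 1 / l := by gcongr; exact hF1 R
          have e : 4 * A ^ 2 * l / l = 4 * A ^ 2 := by field_simp
          rw [e]
          calc _ ≤ (4 * A ^ 2 * 1 / l - 4 * A ^ 2) / 4 := by gcongr
            _ = _ := by ring
        have h6 : A ^ 2 / l ≤ a := by rw [div_le_iff₀ hl]; linarith
        linarith
  have hInteg : IntegrableOn (fun t => Real.exp (w t ^ 2 - t)) (Set.Ioi a) := by
    apply integrableOn_Ioi_of_intervalIntegral_norm_bounded (Real.exp 1 / l) a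
      (b := fun R : ℝ => R) (l := atTop)
    · intro R
      exact (hfc.integrableOn_Icc).mono_set Set.Ioc_subset_Icc_self
    · exact tendsto_id
    · filter_upwards [eventually_ge_atTop a] with R hR
      simpa [abs_of_pos, Real.exp_pos] using hb R hR
  rw [← ofReal_integral_eq_lintegral_ofReal hInteg (Eventually.of_forall fun t => (Real.exp_pos _).le)]
  apply ENNReal.ofReal_le_ofReal
  apply le_of_tendsto (intervalIntegral_tendsto_integral_Ioi a hInteg tendsto_id)
  filter_upwards [eventually_ge_atTop a] with R hR using hb R hR

lemma cc_exp_tail (g T : ℝ) (hg : 0 < g) :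
    ∫⁻ t in Set.Ioi T, ENNReal.ofReal (Real.exp (-g * t)) = ENNReal.ofReal (Real.exp (-g * T) / g) := by
  rw [← ofReal_integral_eq_lintegral_ofReal (integrableOn_exp_mul_Ioi (by linarith) T)
    (Eventually.of_forall fun t => (Real.exp_pos _).le)]
  rw [integral_exp_mul_Ioi (by linarith) T]
  congr 1
  field_simp

lemma cc_oneD (w F : ℝ → ℝ) (hF : Monotone F) (hF0 : ∀ t, 0 ≤ F t) (hF1 : ∀ t, F t ≤ 1)
    (hw : Monotone w) (hw0 : w 0 = 0)
    (h : ∀ s t, s ≤ t → (w t - w s) ^ 2 ≤ (F t - F s) * (t - s))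
    (g T : ℝ) (hg : 0 < g) (hg1 : g < 1) (hT : 0 < T) :
    ∫⁻ t in Set.Ioi (0 : ℝ), ENNReal.ofReal ((Real.exp (w t ^ 2) - 1) * Real.exp (-t)) ≤
      ENNReal.ofReal (Real.exp (w T ^ 2) - 1) + ENNReal.ofReal (Real.exp (-g * T) / g)
        + ENNReal.ofReal (Real.exp 1 / (1 - g)) := by
  have hwc : Continuous w := cc_holder_cont w F hF h
  have hwn : ∀ t, 0 ≤ t → 0 ≤ w t := fun t ht => hw0 ▸ hw ht
  set P : Set ℝ := {t | T ≤ t ∧ (1 - g) * t ≤ w t ^ 2} with hP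
  obtain ⟨S, hSm, hS, hSP⟩ : ∃ S : Set ℝ, MeasurableSet S ∧
      ∫⁻ t in S, ENNReal.ofReal (Real.exp (w t ^ 2 - t)) ≤ ENNReal.ofReal (Real.exp 1 / (1 - g))
      ∧ P ⊆ insert (sInf P) S := by
    rcases P.eq_empty_or_nonempty with hPe | hPn
    · exact ⟨∅, MeasurableSet.empty, by simp, by simp [hPe]⟩
    · have hcl : IsClosed P := by
        apply IsClosed.inter (isClosed_le continuous_const continuous_id)
        exact isClosed_le (f := fun t : ℝ => (1 - g) * t) (g := fun t => w t ^ 2)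
          (by fun_prop) (by fun_prop)
      have hbdd : BddBelow P := ⟨T, fun t ht => ht.1⟩
      have hmem := hcl.csInf_mem hPn hbdd
      set a := sInf P
      have ha : 0 < a := hT.trans_le hmem.1
      have h1 := h 0 a ha.le
      have hA : w a ^ 2 ≤ F a * a := by
        rw [hw0] at h1
        have := hF0 0
        nlinarith
      have hFa : 1 - g ≤ F a := by
        have := hmem.2.trans hA
        exact le_of_mul_le_mul_right this ha
      refine ⟨Set.Ioi a, measurableSet_Ioi, ?_, ?_⟩
      · refine (cc_tail w F hF hF1 hw h a (hwn a ha.le) (by linarith) hA).trans ?_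
        apply ENNReal.ofReal_le_ofReal
        apply div_le_div_of_nonneg_left (Real.exp_pos _).le (by linarith) hFa
      · intro t ht
        rcases eq_or_lt_of_le (csInf_le hbdd ht) with h | h
        · left; exact h.symm
        · right; exact h
  have hmeas : ∀ f : ℝ → ℝ, Continuous f → Measurable fun t => ENNReal.ofReal (f t) :=
    fun f hf => hf.measurable.ennreal_ofReal
  calc _ ≤ ∫⁻ t in Set.Ioi (0 : ℝ), (ENNReal.ofReal (Real.exp (w T ^ 2) - 1) * ENNReal.ofReal (Real.exp (-1 * t))
        + (Set.Ioi T).indicator (fun t => ENNReal.ofReal (Real.exp (-g * t))) t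
        + S.indicator (fun t => ENNReal.ofReal (Real.exp (w t ^ 2 - t))) t) := by
        apply lintegral_mono_ae
        have hne : ∀ᵐ t ∂(volume.restrict (Set.Ioi (0:ℝ))), t ≠ sInf P :=
          ae_restrict_of_ae (Measure.ae_ne volume (sInf P))
        filter_upwards [ae_restrict_mem measurableSet_Ioi, hne] with t ht hta
        have ht0 : 0 < t := ht
        rcases le_or_gt t T with h1 | h1
        · have : ENNReal.ofReal ((Real.exp (w t ^ 2) - 1) * Real.exp (-t)) ≤
            ENNReal.ofReal (Real.exp (w T ^ 2) - 1) * ENNReal.ofReal (Real.exp (-1 * t)) := by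
            rw [← ENNReal.ofReal_mul' (Real.exp_pos _).le]
            apply ENNReal.ofReal_le_ofReal
            rw [neg_one_mul]
            have := hw h1
            have := hwn t ht0.le
            gcongr
          exact this.trans (le_add_right (le_add_right le_rfl))
        · have hle : (Real.exp (w t ^ 2) - 1) * Real.exp (-t) ≤ Real.exp (w t ^ 2 - t) := by
            rw [sub_eq_add_neg (w t ^ 2), Real.exp_add]
            nlinarith [Real.exp_pos (-t)]
          by_cases hS' : t ∈ S
          · rw [Set.indicator_of_mem hS']
            exact (ENNReal.ofReal_le_ofReal hle).trans le_add_self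
          · have hnP : t ∉ P := fun hp => by
              rcases hSP hp with h | h
              · exact hta h
              · exact hS' h
            have hlt : w t ^ 2 < (1 - g) * t := by
              by_contra hc
              exact hnP ⟨h1.le, not_lt.1 hc⟩
            rw [Set.indicator_of_mem (show t ∈ Set.Ioi T from h1)]
            refine le_trans (ENNReal.ofReal_le_ofReal (hle.trans ?_)) (le_add_right le_add_self)
            rw [Real.exp_le_exp]; linarith
    _ ≤ _ := by
        rw [lintegral_add_right, lintegral_add_right, lintegral_const_mul]
        · gcongr ?_ + ?_ + ?_
          · rw [cc_exp_tail 1 0 one_pos]; simp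
          · refine (setLIntegral_le_lintegral _ _).trans ?_
            rw [lintegral_indicator measurableSet_Ioi, cc_exp_tail g T hg]
          · refine (setLIntegral_le_lintegral _ _).trans ?_
            rw [lintegral_indicator hSm]; exact hS
        · exact hmeas _ (by fun_prop)
        · exact (hmeas _ (by fun_prop)).indicator measurableSet_Ioi
        · exact (hmeas _ (by fun_prop)).indicator hSm


/-- The function `θ - sin θ cos θ` is strictly monotone. -/
lemma cc_phi_strictMono : StrictMono fun θ : ℝ => θ - Real.sin θ * Real.cos θ := by
  intro a b hab
  have hd : 0 < b - a := by linarith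
  have h1 : Real.sin b * Real.cos b - Real.sin a * Real.cos a = Real.sin (b - a) * Real.cos (a + b) := by
    rw [Real.sin_sub, Real.cos_add]
    have h1 := Real.sin_sq_add_cos_sq a
    have h2 := Real.sin_sq_add_cos_sq b
    linear_combination (-Real.sin b * Real.cos b) * h1 + (Real.sin a * Real.cos a) * h2
  have h2 : |Real.sin (b - a)| < b - a := by
    have := Real.abs_sin_lt_abs (x := b - a) hd.ne'
    rwa [abs_of_pos hd] at this
  have h3 : Real.sin (b - a) * Real.cos (a + b) ≤ |Real.sin (b - a)| := by
    refine (le_abs_self _).trans ?_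
    rw [abs_mul]
    exact mul_le_of_le_one_right (abs_nonneg _) (Real.abs_cos_le_one _)
  simp only
  linarith

lemma cc_phi_surj : Function.Surjective fun θ : ℝ => θ - Real.sin θ * Real.cos θ := by
  have hb : ∀ θ : ℝ, |Real.sin θ * Real.cos θ| ≤ 1 := by
    intro θ
    rw [abs_mul]
    exact mul_le_one₀ (Real.abs_sin_le_one _) (abs_nonneg _) (Real.abs_cos_le_one _)
  apply Continuous.surjective (by fun_prop)
  · apply tendsto_atTop_mono (f := fun θ : ℝ => θ - 1)
    · intro θ
      have := (abs_le.1 (hb θ)).2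
      linarith
    · exact tendsto_atTop_add_const_right _ (-1) tendsto_id
  · apply tendsto_atBot_mono (f := fun θ : ℝ => θ + 1)
    · intro θ
      have := (abs_le.1 (hb θ)).1
      linarith
    · exact tendsto_atBot_add_const_right _ 1 tendsto_id

/-- A continuous inverse. -/
lemma cc_phi_inv : ∃ Ψ : ℝ → ℝ, Continuous Ψ ∧
    (∀ y, Ψ y - Real.sin (Ψ y) * Real.cos (Ψ y) = y) ∧
    (∀ y, 0 < y → y < π → 0 < Ψ y ∧ Ψ y < π) ∧
    (∀ y, 0 < y → y < π → HasDerivAt Ψ (2 * Real.sin (Ψ y) ^ 2)⁻¹ y) := by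
  set e := StrictMono.orderIsoOfSurjective _ cc_phi_strictMono cc_phi_surj with he
  have hinv : ∀ y, e.symm y - Real.sin (e.symm y) * Real.cos (e.symm y) = y := by
    intro y
    exact e.apply_symm_apply y
  have hcont : Continuous e.symm := e.symm.continuous
  have hrange : ∀ y, 0 < y → y < π → 0 < e.symm y ∧ e.symm y < π := by
    intro y h0 h1
    constructor
    · by_contra hc
      have := cc_phi_strictMono.monotone (not_lt.1 hc)
      simp only [hinv, Real.sin_zero] at this
      linarith
    · by_contra hc
      have := cc_phi_strictMono.monotone (not_lt.1 hc)
      simp only [hinv, Real.sin_pi] at this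
      linarith
  refine ⟨e.symm, hcont, hinv, hrange, ?_⟩
  intro y h0 h1
  obtain ⟨r0, r1⟩ := hrange y h0 h1
  have hs := Real.sin_pos_of_pos_of_lt_pi r0 r1
  have hd : HasDerivAt (fun θ : ℝ => θ - Real.sin θ * Real.cos θ) (2 * Real.sin (e.symm y) ^ 2) (e.symm y) := by
    have := (hasDerivAt_id (e.symm y)).sub ((Real.hasDerivAt_sin (e.symm y)).mul (Real.hasDerivAt_cos (e.symm y)))
    refine this.congr_deriv ?_
    have := Real.sin_sq_add_cos_sq (e.symm y)
    linear_combination (-1) * this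
  exact HasDerivAt.of_local_left_inverse hcont.continuousAt hd (by positivity)
    (Eventually.of_forall hinv)

local notation "μI" => (volume.restrict (Set.Ioc (-1 : ℝ) 1))

set_option maxHeartbeats 1600000 in
/-- Sharp `W^{1,1} → L²` Sobolev inequality in the plane (regularised), via the Knothe map. -/
lemma cc_sobolev_eps (g p q D : ℝ × ℝ → ℝ) (hgc : Continuous g) (hg0 : ∀ z, 0 ≤ g z)
    (hsx : ∀ y, g (-1, y) = 0 ∧ g (1, y) = 0) (hsy : ∀ x, g (x, -1) = 0 ∧ g (x, 1) = 0)
    (hp : ∀ x y, HasDerivAt (fun x => g (x, y)) (p (x, y)) x)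
    (hq : ∀ x y, HasDerivAt (fun y => g (x, y)) (q (x, y)) y)
    (hpm : Measurable p) (hqm : Measurable q)
    (hD0 : ∀ z, 0 ≤ D z) (hD : Integrable D (Measure.prod μI μI))
    (hpq : ∀ z, p z ^ 2 + q z ^ 2 ≤ D z ^ 2) (ε : ℝ) (hε : 0 < ε) :
    2 * √(π / ((∫ z, g z ^ 2 ∂(Measure.prod μI μI)) + 4 * ε)) * (∫ z, g z ^ 2 ∂(Measure.prod μI μI))
      ≤ ∫ z, D z ∂(Measure.prod μI μI) := by
  obtain ⟨Ψ, hΨc, hΨi, hΨr, hΨd⟩ := cc_phi_inv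
  have contint : ∀ f : ℝ × ℝ → ℝ, ContinuousOn f (Set.Icc (-1) 1 ×ˢ Set.Icc (-1) 1) →
      Integrable f (Measure.prod μI μI) := by
    intro f hf
    rw [Measure.prod_restrict]
    have : IntegrableOn f (Set.Icc (-1) 1 ×ˢ Set.Icc (-1) 1) (Measure.prod volume volume) :=
      hf.integrableOn_compact (isCompact_Icc.prod isCompact_Icc)
    exact this.mono_set (Set.prod_mono Set.Ioc_subset_Icc_self Set.Ioc_subset_Icc_self)
  set N := ∫ z, g z ^ 2 ∂(Measure.prod μI μI) with hN
  have hN0 : 0 ≤ N := integral_nonneg fun z => sq_nonneg _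
  set N' := N + 4 * ε with hN'
  have hN'0 : 0 < N' := by positivity
  set G : ℝ × ℝ → ℝ := fun z => ∫ t in (-1 : ℝ)..z.2, g (z.1, t) ^ 2 with hG
  have hGc : Continuous G := by
    apply intervalIntegral.continuous_parametric_intervalIntegral_of_continuous
      (f := fun z : ℝ × ℝ => fun t => g (z.1, t) ^ 2)
    · fun_prop
    · fun_prop
  set F : ℝ → ℝ := fun x => ε + G (x, 1) with hF
  have hFc : Continuous F := by fun_prop
  have hGmono : ∀ x y y', y ≤ y' → G (x, y) ≤ G (x, y') := by
    intro x y y' h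
    have hcx : Continuous fun t => g (x, t) ^ 2 := by fun_prop
    have := intervalIntegral.integral_interval_sub_left (hcx.intervalIntegrable (μ := volume) (-1) y')
      (hcx.intervalIntegrable (-1) y)
    have h2 : 0 ≤ ∫ t in y..y', g (x, t) ^ 2 :=
      intervalIntegral.integral_nonneg h (fun t _ => sq_nonneg _)
    simp only [hG]
    linarith
  have hGm1 : ∀ x, G (x, -1) = 0 := by intro x; simp [hG]
  have hF0 : ∀ x, 0 < F x := by
    intro x
    have := hGmono x (-1) 1 (by norm_num)
    rw [hGm1] at this
    simp only [hF]; linarith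
  set C : ℝ → ℝ := fun x => ε + ∫ s in (-1 : ℝ)..x, F s with hC
  have hCd : ∀ x, HasDerivAt C (F x) x := fun x =>
    (intervalIntegral.integral_hasDerivAt_right (hFc.intervalIntegrable _ _)
      (hFc.stronglyMeasurableAtFilter _ _) hFc.continuousAt).const_add ε
  have hCc : Continuous C := continuous_iff_continuousAt.2 fun t => (hCd t).continuousAt
  have hCmono : Monotone C := monotone_of_hasDerivAt_nonneg hCd (fun t => (hF0 t).le)
  have hC1 : C 1 = N + 3 * ε := by
    have hNe : N = ∫ x in (-1 : ℝ)..1, G (x, 1) := by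
      rw [hN, integral_prod _ (contint _ (by fun_prop))]
      rw [intervalIntegral.integral_of_le (by norm_num)]
      simp only [hG]
      congr 1
      ext x
      rw [intervalIntegral.integral_of_le (by norm_num)]
    have hGc1 : Continuous fun x => G (x, 1) := by fun_prop
    simp only [hC, hF]
    rw [intervalIntegral.integral_add (by simp) (hGc1.intervalIntegrable _ _), ← hNe]
    simp; ring
  have hCm1 : C (-1) = ε := by simp [hC]
  set Θ : ℝ → ℝ := fun x => Ψ (π * C x / N') with hΘ
  have hΘc : Continuous Θ := by fun_prop
  have hCr : ∀ x ∈ Set.Icc (-1 : ℝ) 1, 0 < π * C x / N' ∧ π * C x / N' < π := by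
    intro x hx
    have h1 := hCmono hx.1
    have h2 := hCmono hx.2
    rw [hCm1] at h1
    rw [hC1] at h2
    have : 0 < C x := by linarith
    refine ⟨by positivity, ?_⟩
    rw [div_lt_iff₀ hN'0]
    apply mul_lt_mul_of_pos_left _ Real.pi_pos
    linarith
  set S : ℝ → ℝ := fun x => Real.sin (Θ x) with hS
  have hSc : Continuous S := by fun_prop
  have hS0 : ∀ x ∈ Set.Icc (-1 : ℝ) 1, 0 < S x := by
    intro x hx
    obtain ⟨h1, h2⟩ := hCr x hx
    obtain ⟨h3, h4⟩ := hΨr _ h1 h2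
    exact Real.sin_pos_of_pos_of_lt_pi h3 h4
  set X : ℝ → ℝ := fun x => - Real.cos (Θ x) with hX
  have hXc : Continuous X := by fun_prop
  set dX : ℝ → ℝ := fun x => π * F x / (2 * N' * S x) with hdX
  have hXd : ∀ x ∈ Set.Icc (-1 : ℝ) 1, HasDerivAt X (dX x) x := by
    intro x hx
    obtain ⟨h1, h2⟩ := hCr x hx
    have hs := hS0 x hx
    have d1 : HasDerivAt (fun x => π * C x / N') (π * F x / N') x :=
      ((hCd x).const_mul π).div_const N'
    have d2 : HasDerivAt Θ ((2 * Real.sin (Ψ (π * C x / N')) ^ 2)⁻¹ * (π * F x / N')) x :=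
      HasDerivAt.comp x (hΨd _ h1 h2) d1
    have d3 := d2.cos.neg
    refine d3.congr_deriv ?_
    change -(-S x * ((2 * S x ^ 2)⁻¹ * (π * F x / N'))) = π * F x / (2 * N' * S x)
    field_simp
  have hdXc : ContinuousOn dX (Set.Icc (-1) 1) := by
    apply ContinuousOn.div (by fun_prop) (by fun_prop)
    intro x hx
    have := hS0 x hx
    positivity
  set b : ℝ × ℝ → ℝ := fun z => S z.1 * (2 * (G z / F z.1) - 1) with hb
  have hbc : Continuous b := by
    have : Continuous fun z : ℝ × ℝ => G z / F z.1 :=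
      hGc.div (by fun_prop) (fun z => (hF0 _).ne')
    fun_prop
  set db : ℝ × ℝ → ℝ := fun z => S z.1 * (2 * (g z ^ 2 / F z.1)) with hdb
  have hdbc : Continuous db := by
    have : Continuous fun z : ℝ × ℝ => g z ^ 2 / F z.1 :=
      Continuous.div (by fun_prop) (by fun_prop) (fun z => (hF0 _).ne')
    fun_prop
  have hbd : ∀ x y, HasDerivAt (fun y => b (x, y)) (db (x, y)) y := by
    intro x y
    have hcx : Continuous fun t => g (x, t) ^ 2 := by fun_prop
    have d1 : HasDerivAt (fun y => G (x, y)) (g (x, y) ^ 2) y :=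
      intervalIntegral.integral_hasDerivAt_right (hcx.intervalIntegrable _ _)
        (hcx.stronglyMeasurableAtFilter _ _) hcx.continuousAt
    exact ((((d1.div_const (F x)).const_mul 2).sub_const 1).const_mul (S x))
  -- integrability
  have hpi : Integrable p (Measure.prod μI μI) := by
    apply hD.mono' hpm.aestronglyMeasurable
    refine Eventually.of_forall fun z => ?_
    rw [Real.norm_eq_abs]
    apply abs_le_of_sq_le_sq _ (hD0 z)
    nlinarith [hpq z, sq_nonneg (q z)]
  have hqi : Integrable q (Measure.prod μI μI) := by
    apply hD.mono' hqm.aestronglyMeasurable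
    refine Eventually.of_forall fun z => ?_
    rw [Real.norm_eq_abs]
    apply abs_le_of_sq_le_sq _ (hD0 z)
    nlinarith [hpq z, sq_nonneg (p z)]
  have hX1 : ∀ x, |X x| ≤ 1 := fun x => by
    simp only [hX, abs_neg]; exact Real.abs_cos_le_one _
  have hpXi : Integrable (fun z => p z * X z.1) (Measure.prod μI μI) := by
    apply hpi.norm.mono' (hpm.mul (hXc.measurable.comp measurable_fst)).aestronglyMeasurable
    refine Eventually.of_forall fun z => ?_
    change ‖p z * X z.1‖ ≤ _
    rw [norm_mul]
    exact mul_le_of_le_one_right (norm_nonneg _) (hX1 _)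
  have hsq : ∀ᵐ z ∂(Measure.prod μI μI), z.1 ∈ Set.Icc (-1 : ℝ) 1 ∧ z.2 ∈ Set.Icc (-1 : ℝ) 1 := by
    rw [Measure.prod_restrict]
    filter_upwards [ae_restrict_mem (measurableSet_Ioc.prod measurableSet_Ioc)] with z hz
    exact ⟨Set.Ioc_subset_Icc_self hz.1, Set.Ioc_subset_Icc_self hz.2⟩
  have hXb : ∀ x y, y ∈ Set.Icc (-1 : ℝ) 1 → X x ^ 2 + b (x, y) ^ 2 ≤ 1 := by
    intro x y hy
    have h1 := hGmono x _ _ hy.1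
    have h2 := hGmono x _ _ hy.2
    rw [hGm1] at h1
    have hr0 : 0 ≤ G (x, y) / F x := div_nonneg h1 (hF0 x).le
    have hr1 : G (x, y) / F x ≤ 1 := by
      rw [div_le_one (hF0 x)]; simp only [hF]; linarith
    have h3 : (2 * (G (x, y) / F x) - 1) ^ 2 ≤ 1 := by nlinarith
    have h4 : X x ^ 2 + S x ^ 2 = 1 := by
      simp only [hX, hS]; rw [neg_sq]; exact Real.cos_sq_add_sin_sq _
    simp only [hb]
    nlinarith [sq_nonneg (S x)]
  have hqbi : Integrable (fun z => q z * b z) (Measure.prod μI μI) := by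
    apply hqi.norm.mono' (hqm.mul hbc.measurable).aestronglyMeasurable
    filter_upwards [hsq] with z hz
    change ‖q z * b z‖ ≤ _
    rw [norm_mul]
    apply mul_le_of_le_one_right (norm_nonneg _)
    rw [Real.norm_eq_abs, abs_le_one_iff_mul_self_le_one]
    have := hXb z.1 z.2 hz.2
    nlinarith [sq_nonneg (X z.1)]
  have hgdX : Integrable (fun z => g z * dX z.1) (Measure.prod μI μI) := by
    apply contint
    apply hgc.continuousOn.mul
    exact hdXc.comp (by fun_prop) (fun z hz => hz.1)
  have hgdb : Integrable (fun z => g z * db z) (Measure.prod μI μI) := by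
    apply contint
    fun_prop
  -- integration by parts
  have hI1 : ∫ z, (p z * X z.1 + g z * dX z.1) ∂(Measure.prod μI μI) = 0 := by
    have hi : Integrable (fun z => p z * X z.1 + g z * dX z.1) (Measure.prod μI μI) := hpXi.add hgdX
    rw [integral_prod_symm _ hi]
    apply integral_eq_zero_of_ae
    filter_upwards [hi.prod_left_ae] with y hy
    rw [← intervalIntegral.integral_of_le (by norm_num)]
    rw [intervalIntegral.integral_eq_sub_of_hasDerivAt (f := fun x => g (x, y) * X x)]
    · simp [hsx y]
    · intro x hx
      rw [Set.uIcc_of_le (by norm_num)] at hx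
      exact (hp x y).mul (hXd x hx)
    · rw [intervalIntegrable_iff_integrableOn_Ioc_of_le (by norm_num)]
      exact hy
  have hI2 : ∫ z, (q z * b z + g z * db z) ∂(Measure.prod μI μI) = 0 := by
    have hi : Integrable (fun z => q z * b z + g z * db z) (Measure.prod μI μI) := hqbi.add hgdb
    rw [integral_prod _ hi]
    apply integral_eq_zero_of_ae
    filter_upwards [hi.prod_right_ae] with x hx
    rw [← intervalIntegral.integral_of_le (by norm_num)]
    rw [intervalIntegral.integral_eq_sub_of_hasDerivAt (f := fun y => g (x, y) * b (x, y))]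
    · simp [hsy x]
    · intro y hy
      exact (hq x y).mul (hbd x y)
    · rw [intervalIntegrable_iff_integrableOn_Ioc_of_le (by norm_num)]
      exact hx
  have hgi : Integrable (fun z => 2 * √(π / N') * g z ^ 2) (Measure.prod μI μI) :=
    contint _ (by fun_prop)
  have hfin : ∫ z, (2 * √(π / N') * g z ^ 2) ∂(Measure.prod μI μI) ≤
      ∫ z, (D z + ((p z * X z.1 + g z * dX z.1) + (q z * b z + g z * db z))) ∂(Measure.prod μI μI) := by
    apply integral_mono_ae hgi (hD.add ((hpXi.add hgdX).add (hqbi.add hgdb)))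
    filter_upwards [hsq] with z hz
    have hs := hS0 z.1 hz.1
    have hf := hF0 z.1
    have h1 := hXb z.1 z.2 hz.2
    have hD' : -(p z * X z.1 + q z * b z) ≤ D z := by
      have h2 : (p z * X z.1 + q z * b z) ^ 2 ≤ D z ^ 2 := by
        refine le_trans ?_ (hpq z)
        have : (p z * X z.1 + q z * b z) ^ 2 ≤ (p z ^ 2 + q z ^ 2) * (X z.1 ^ 2 + b z ^ 2) := by
          nlinarith [sq_nonneg (p z * b z - q z * X z.1)]
        refine this.trans ?_
        apply mul_le_of_le_one_right (by positivity) h1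
      exact (neg_le_abs _).trans (abs_le_of_sq_le_sq h2 (hD0 z))
    have hdX0 : 0 ≤ dX z.1 := by simp only [hdX]; positivity
    have hdb0 : 0 ≤ db z := by simp only [hdb]; positivity
    have hprod : dX z.1 * db z = (√(π / N') * g z) ^ 2 := by
      rw [mul_pow, Real.sq_sqrt (by positivity)]
      simp only [hdX, hdb]
      field_simp
    have hamgm : 2 * (√(π / N') * g z) ≤ dX z.1 + db z := by
      apply (le_abs_self _).trans (abs_le_of_sq_le_sq _ (by positivity))
      nlinarith [sq_nonneg (dX z.1 - db z)]
    have h9 := mul_le_mul_of_nonneg_left hamgm (hg0 z)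
    change 2 * √(π / N') * g z ^ 2 ≤ D z + ((p z * X z.1 + g z * dX z.1) + (q z * b z + g z * db z))
    calc 2 * √(π / N') * g z ^ 2 = g z * (2 * (√(π / N') * g z)) := by ring
      _ ≤ g z * (dX z.1 + db z) := h9
      _ ≤ _ := by linarith
  have i1 : Integrable (fun z => p z * X z.1 + g z * dX z.1) (Measure.prod μI μI) := hpXi.add hgdX
  have i2 : Integrable (fun z => q z * b z + g z * db z) (Measure.prod μI μI) := hqbi.add hgdb
  have i3 : Integrable (fun z => (p z * X z.1 + g z * dX z.1) + (q z * b z + g z * db z))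
    (Measure.prod μI μI) := i1.add i2
  rw [integral_add hD i3, integral_add i1 i2, integral_const_mul] at hfin
  linarith

lemma cc_sobolev (g p q D : ℝ × ℝ → ℝ) (hgc : Continuous g) (hg0 : ∀ z, 0 ≤ g z)
    (hsx : ∀ y, g (-1, y) = 0 ∧ g (1, y) = 0) (hsy : ∀ x, g (x, -1) = 0 ∧ g (x, 1) = 0)
    (hp : ∀ x y, HasDerivAt (fun x => g (x, y)) (p (x, y)) x)
    (hq : ∀ x y, HasDerivAt (fun y => g (x, y)) (q (x, y)) y)
    (hpm : Measurable p) (hqm : Measurable q)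
    (hD0 : ∀ z, 0 ≤ D z) (hD : Integrable D (Measure.prod μI μI))
    (hpq : ∀ z, p z ^ 2 + q z ^ 2 ≤ D z ^ 2) :
    4 * π * (∫ z, g z ^ 2 ∂(Measure.prod μI μI)) ≤ (∫ z, D z ∂(Measure.prod μI μI)) ^ 2 := by
  have H := cc_sobolev_eps g p q D hgc hg0 hsx hsy hp hq hpm hqm hD0 hD hpq
  set N := ∫ z, g z ^ 2 ∂(Measure.prod μI μI) with hN
  have hN0 : 0 ≤ N := integral_nonneg fun z => sq_nonneg _
  rcases hN0.eq_or_lt with h | h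
  · rw [← h]; simp; positivity
  have hlim : Tendsto (fun ε : ℝ => 2 * √(π / (N + 4 * ε)) * N) (𝓝[>] 0)
      (𝓝 (2 * √(π / (N + 4 * 0)) * N)) := by
    apply tendsto_nhdsWithin_of_tendsto_nhds
    apply ContinuousAt.tendsto (f := fun ε : ℝ => 2 * √(π / (N + 4 * ε)) * N)
    have : ContinuousAt (fun ε : ℝ => π / (N + 4 * ε)) 0 :=
      ContinuousAt.div (by fun_prop) (by fun_prop) (by simpa using h.ne')
    fun_prop
  have h1 := le_of_tendsto hlim (by
    filter_upwards [self_mem_nhdsWithin] with ε hε using H ε hε)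
  have h2 : (2 * √(π / (N + 4 * 0)) * N) ^ 2 = 4 * π * N := by
    rw [mul_pow, mul_pow, mul_zero, add_zero, Real.sq_sqrt (by positivity)]
    field_simp; ring
  rw [← h2]
  gcongr


/-- Coordinates on the plane. -/
def ccE (z : ℝ × ℝ) : E := z.1 • EuclideanSpace.single 0 1 + z.2 • EuclideanSpace.single 1 1

lemma ccE_norm (z : ℝ × ℝ) : ‖ccE z‖ ^ 2 = z.1 ^ 2 + z.2 ^ 2 := by
  rw [EuclideanSpace.norm_sq_eq]
  simp [ccE, Fin.sum_univ_two]

lemma ccE_eq : ccE = (MeasurableEquiv.toLp 2 (Fin 2 → ℝ)) ∘ (MeasurableEquiv.finTwoArrow (α := ℝ)).symm := by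
  ext z i
  fin_cases i <;> simp [ccE, MeasurableEquiv.finTwoArrow]

lemma ccE_mp : MeasurePreserving ccE (volume : Measure (ℝ × ℝ)) (volume : Measure E) := by
  have h1 := (volume_preserving_finTwoArrow ℝ).symm
  have h2 := PiLp.volume_preserving_toLp (Fin 2)
  rw [ccE_eq]
  exact h2.comp h1

lemma ccE_emb : MeasurableEmbedding ccE := by
  rw [ccE_eq]
  exact (MeasurableEquiv.measurableEmbedding _).comp (MeasurableEquiv.measurableEmbedding _)

lemma ccE_outside (z : ℝ × ℝ) (hz : 1 ≤ |z.1| ∨ 1 ≤ |z.2|) : ccE z ∉ ball (0 : E) 1 := by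
  intro h
  rw [mem_ball_zero_iff] at h
  have h1 := ccE_norm z
  have h2 : ‖ccE z‖ ^ 2 < 1 := by nlinarith [norm_nonneg (ccE z)]
  rcases hz with hz | hz
  · have : 1 ≤ z.1 ^ 2 := by rw [← sq_abs]; nlinarith
    nlinarith [sq_nonneg z.2]
  · have : 1 ≤ z.2 ^ 2 := by rw [← sq_abs]; nlinarith
    nlinarith [sq_nonneg z.1]

lemma ccE_outside' (z : ℝ × ℝ) (hz : z ∉ Set.Ioc (-1 : ℝ) 1 ×ˢ Set.Ioc (-1 : ℝ) 1) :
    ccE z ∉ ball (0 : E) 1 := by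
  apply ccE_outside
  by_contra hc
  push Not at hc
  have h1 := abs_lt.1 hc.1
  have h2 := abs_lt.1 hc.2
  exact hz ⟨⟨h1.1, h1.2.le⟩, ⟨h2.1, h2.2.le⟩⟩

lemma cc_transfer (f : E → ℝ) (hf : ∀ x, x ∉ ball (0 : E) 1 → f x = 0) :
    ∫ z, f (ccE z) ∂(Measure.prod μI μI) = ∫ x in ball (0 : E) 1, f x := by
  rw [Measure.prod_restrict, setIntegral_eq_integral_of_forall_compl_eq_zero (f := f) hf]
  rw [setIntegral_eq_integral_of_forall_compl_eq_zero (f := fun z => f (ccE z))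
    (fun z hz => hf _ (ccE_outside' z hz))]
  exact ccE_mp.integral_comp ccE_emb f

lemma cc_transfer_int (f : E → ℝ) (hf : ∀ x, x ∉ ball (0 : E) 1 → f x = 0)
    (hi : IntegrableOn f (ball (0 : E) 1)) :
    Integrable (fun z => f (ccE z)) (Measure.prod μI μI) := by
  have h1 : Integrable f := by
    rw [← integrableOn_iff_integrable_of_support_subset (s := ball (0 : E) 1)]
    · exact hi
    · intro x hx
      by_contra hc
      exact hx (hf x hc)
  rw [Measure.prod_restrict]
  have h2 : Integrable (f ∘ ccE) (volume : Measure (ℝ × ℝ)) :=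
    (ccE_mp.integrable_comp_emb ccE_emb).2 h1
  exact Integrable.integrableOn h2

lemma cc_sobolev_E (v : E → ℝ) (hv : Differentiable ℝ v)
    (hz : ∀ x : E, x ∉ ball (0 : E) 1 → v x = 0)
    (hi : IntegrableOn (fun x => ‖fderiv ℝ v x‖) (ball (0 : E) 1))
    (φ k : ℝ → ℝ) (hk : Continuous k) (hφ : ∀ t, HasDerivAt φ (k t) t) (hφ0 : φ 0 = 0)
    (hφn : ∀ t, 0 ≤ φ t) (hk0 : k 0 = 0) (hk1 : ∀ t, |k t| ≤ 1) :
    4 * π * ∫ x in ball (0 : E) 1, φ (v x) ^ 2 ≤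
      (∫ x in ball (0 : E) 1, |k (v x)| * ‖fderiv ℝ v x‖) ^ 2 := by
  have hφc : Continuous φ := continuous_iff_continuousAt.2 fun t => (hφ t).continuousAt
  have hvc : Continuous v := hv.continuous
  have hEc : Continuous ccE := by unfold ccE; fun_prop
  have hfm : Measurable (fderiv ℝ v) := measurable_fderiv ℝ v
  set e1 : E := EuclideanSpace.single 0 1
  set e2 : E := EuclideanSpace.single 1 1
  have hzo : ∀ z : ℝ × ℝ, (1 ≤ |z.1| ∨ 1 ≤ |z.2|) → φ (v (ccE z)) = 0 := by
    intro z h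
    rw [hz _ (ccE_outside z h), hφ0]
  have hDi : IntegrableOn (fun x => |k (v x)| * ‖fderiv ℝ v x‖) (ball (0 : E) 1) := by
    apply Integrable.mono' hi
    · exact ((hk.comp hvc).abs.measurable.mul hfm.norm).aestronglyMeasurable
    · refine Eventually.of_forall fun x => ?_
      simp only [norm_mul, Real.norm_eq_abs, abs_abs, abs_norm]
      exact mul_le_of_le_one_left (norm_nonneg _) (hk1 _)
  have hD0 : ∀ x, x ∉ ball (0 : E) 1 → |k (v x)| * ‖fderiv ℝ v x‖ = 0 := by
    intro x hx; rw [hz x hx, hk0]; simp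
  have := cc_sobolev (fun z => φ (v (ccE z)))
    (fun z => k (v (ccE z)) * fderiv ℝ v (ccE z) e1)
    (fun z => k (v (ccE z)) * fderiv ℝ v (ccE z) e2)
    (fun z => |k (v (ccE z))| * ‖fderiv ℝ v (ccE z)‖)
    (by fun_prop) (fun z => hφn _)
    (fun y => ⟨hzo _ (by simp), hzo _ (by simp)⟩)
    (fun x => ⟨hzo _ (by simp), hzo _ (by simp)⟩)
    (by
      intro x y
      have d1 : HasDerivAt (fun x => ccE (x, y)) e1 x := by
        have := ((hasDerivAt_id x).smul_const e1).add_const (y • e2)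
        simpa [ccE] using this
      have d2 := (hv (ccE (x, y))).hasFDerivAt.comp_hasDerivAt x d1
      exact (hφ _).comp x d2)
    (by
      intro x y
      have d1 : HasDerivAt (fun y => ccE (x, y)) e2 y := by
        have := ((hasDerivAt_id y).smul_const e2).const_add (x • e1)
        simpa [ccE] using this
      have d2 := (hv (ccE (x, y))).hasFDerivAt.comp_hasDerivAt y d1
      exact (hφ _).comp y d2)
    (by
      apply Measurable.mul
      · exact (hk.comp (hvc.comp hEc)).measurable
      · exact (measurable_fderiv_apply_const ℝ v e1).comp hEc.measurable)
    (by
      apply Measurable.mul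
      · exact (hk.comp (hvc.comp hEc)).measurable
      · exact (measurable_fderiv_apply_const ℝ v e2).comp hEc.measurable)
    (fun z => by positivity)
    (cc_transfer_int (fun x => |k (v x)| * ‖fderiv ℝ v x‖) hD0 hDi)
    (by
      intro z
      set L := fderiv ℝ v (ccE z)
      have h1 : L (ccE (L e1, L e2)) = L e1 ^ 2 + L e2 ^ 2 := by
        simp only [ccE, map_add, map_smul, smul_eq_mul]
        ring
      have h2 := L.le_opNorm (ccE (L e1, L e2))
      rw [h1, Real.norm_eq_abs, abs_of_nonneg (by positivity)] at h2
      have h3 := ccE_norm (L e1, L e2)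
      simp only at h3
      have h4 : L e1 ^ 2 + L e2 ^ 2 ≤ ‖L‖ ^ 2 := by
        rw [← h3] at h2 ⊢
        rcases (norm_nonneg (ccE (L e1, L e2))).eq_or_lt with h | h
        · rw [← h]; simp
        · have : ‖ccE (L e1, L e2)‖ ≤ ‖L‖ := by
            rw [sq] at h2
            exact le_of_mul_le_mul_right h2 h
          gcongr
      rw [mul_pow, mul_pow, mul_pow, sq_abs, ← mul_add]
      gcongr)
  rw [cc_transfer (fun x => φ (v x) ^ 2) (by intro x hx; simp [hz x hx, hφ0]),
    cc_transfer (fun x => |k (v x)| * ‖fderiv ℝ v x‖) hD0] at this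
  exact this


lemma cc_cs {α : Type*} [MeasurableSpace α] (μ : Measure α) [IsFiniteMeasure μ] (f : α → ℝ)
    (hf : Integrable f μ) (hf2 : Integrable (fun x => f x ^ 2) μ) :
    (∫ x, f x ∂μ) ^ 2 ≤ (∫ x, f x ^ 2 ∂μ) * μ.real Set.univ := by
  set M := μ.real Set.univ with hM
  have hM0 : 0 ≤ M := measureReal_nonneg
  rcases hM0.eq_or_lt with h | h
  · have : μ = 0 := by
      rw [← Measure.measure_univ_eq_zero]
      have := h.symm
      rw [hM, measureReal_eq_zero_iff] at this
      exact this
    simp [this]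
  · set a := ∫ x, f x ∂μ with ha
    set l := a / M with hl
    have h0 : 0 ≤ ∫ x, (f x - l) ^ 2 ∂μ := integral_nonneg fun x => sq_nonneg _
    have e : (fun x => (f x - l) ^ 2) = fun x => (f x ^ 2 - 2 * l * f x) + l ^ 2 := by
      ext x; ring
    have i1 : Integrable (fun x => 2 * l * f x) μ := hf.const_mul _
    have i2 : Integrable (fun x => f x ^ 2 - 2 * l * f x) μ := hf2.sub i1
    rw [e, integral_add i2 (integrable_const _),
      integral_sub hf2 i1, integral_const_mul, integral_const, ← ha] at h0
    simp only [smul_eq_mul, ← hM] at h0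
    have h1 : l * M = a := by rw [hl]; field_simp
    have h2 : l * (l * M) = l * a := by rw [h1]
    have h3 : 0 ≤ (∫ x, f x ^ 2 ∂μ) - l * a := by nlinarith
    have h4 := mul_nonneg h3 h.le
    nlinarith

lemma cc_cutoff (a b c d : ℝ) (ha : 0 ≤ a) (hab : a < b) (hbc : b ≤ c) (hcd : c < d) :
    ∃ φ k : ℝ → ℝ, Continuous k ∧ (∀ t, HasDerivAt φ (k t) t) ∧ φ 0 = 0 ∧ (∀ t, 0 ≤ φ t) ∧ k 0 = 0
      ∧ (∀ t, |k t| ≤ 1) ∧ (∀ t, ¬ (a < |t| ∧ |t| < d) → k t = 0) ∧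
      (∀ t, d ≤ |t| → c - b ≤ φ t) := by
  obtain ⟨f, hf0, hf1, hf⟩ := exists_continuous_zero_one_of_isClosed
    (s := Set.Iic a ∪ Set.Ici d) (t := Set.Icc b c)
    (isClosed_Iic.union isClosed_Ici) isClosed_Icc (by
      rw [Set.disjoint_left]
      rintro x (h | h) h2
      · have h' : x ≤ a := h
        linarith [h2.1]
      · have h' : d ≤ x := h
        linarith [h2.2])
  have hfc : Continuous f := f.continuous
  have hK : ∀ t, HasDerivAt (fun u => ∫ s in a..u, f s) (f t) t := fun t =>
    intervalIntegral.integral_hasDerivAt_right (hfc.intervalIntegrable _ _)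
      (hfc.stronglyMeasurableAtFilter _ _) hfc.continuousAt
  set K : ℝ → ℝ := fun u => ∫ s in a..u, f s with hKdef
  have hKm : Monotone K := monotone_of_hasDerivAt_nonneg hK (fun t => (hf t).1)
  have hKa : K a = 0 := by simp [hKdef]
  have hKle : ∀ u, u ≤ a → K u = 0 := by
    intro u hu
    have : K u = ∫ s in a..u, (0 : ℝ) := by
      apply intervalIntegral.integral_congr
      intro s hs
      rw [Set.uIcc_of_ge hu] at hs
      exact hf0 (Or.inl hs.2)
    rw [this]; simp
  have hKn : ∀ u, 0 ≤ K u := by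
    intro u
    rcases le_total u a with h | h
    · rw [hKle u h]
    · rw [← hKa]; exact hKm h
  have hKd : ∀ u, d ≤ u → c - b ≤ K u := by
    intro u hu
    have h1 : K c - K b = c - b := by
      have : K c - K b = ∫ s in b..c, f s :=
        intervalIntegral.integral_interval_sub_left (hfc.intervalIntegrable _ _) (hfc.intervalIntegrable _ _)
      rw [this]
      have : ∫ s in b..c, f s = ∫ s in b..c, (1 : ℝ) := by
        apply intervalIntegral.integral_congr
        intro s hs
        rw [Set.uIcc_of_le hbc] at hs
        exact hf1 hs
      rw [this]; simp
    have := hKm (show c ≤ u by linarith)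
    have := hKn b
    linarith
  have hf0a : ∀ s, s ≤ a → f s = 0 := fun s hs => hf0 (Or.inl hs)
  have hf0d : ∀ s, d ≤ s → f s = 0 := fun s hs => hf0 (Or.inr hs)
  refine ⟨fun t => K t + K (-t), fun t => f t - f (-t), by fun_prop, ?_, ?_, ?_, ?_, ?_, ?_, ?_⟩
  · intro t
    have h1 := (hK (-t)).comp t (hasDerivAt_neg t)
    have h2 := (hK t).add h1
    refine h2.congr_deriv ?_
    ring
  · simp [hKle 0 ha]
  · intro t; have := hKn t; have := hKn (-t); simp only; linarith
  · simp
  · intro t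
    have h1 := hf t
    have h2 := hf (-t)
    rw [abs_le]; constructor <;> linarith [h1.1, h1.2, h2.1, h2.2]
  · intro t ht
    have : f t = 0 ∧ f (-t) = 0 := by
      rcases le_or_gt (|t|) a with h | h
      · exact ⟨hf0a _ ((le_abs_self t).trans h), hf0a _ ((neg_le_abs t).trans h)⟩
      · have h2 : d ≤ |t| := by
          by_contra hc
          exact ht ⟨h, not_le.1 hc⟩
        rcases le_total 0 t with h3 | h3
        · rw [abs_of_nonneg h3] at h2
          exact ⟨hf0d _ h2, hf0a _ (by linarith)⟩
        · rw [abs_of_nonpos h3] at h2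
          exact ⟨hf0a _ (by linarith), hf0d _ h2⟩
    simp [this.1, this.2]
  · intro t ht
    rcases le_total 0 t with h3 | h3
    · rw [abs_of_nonneg h3] at ht
      have := hKd t ht; have := hKn (-t); simp only; linarith
    · rw [abs_of_nonpos h3] at ht
      have := hKd (-t) ht; have := hKn t; simp only; linarith

lemma cc_int1 (v : E → ℝ)
    (hi : IntegrableOn (fun x => ‖fderiv ℝ v x‖ ^ 2) (ball (0 : E) 1)) :
    IntegrableOn (fun x => ‖fderiv ℝ v x‖) (ball (0 : E) 1) := by
  have hm : Measurable fun x => ‖fderiv ℝ v x‖ := (measurable_fderiv ℝ v).norm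
  have h1 : IntegrableOn (fun x => ‖fderiv ℝ v x‖ ^ 2 + 1) (ball (0 : E) 1) :=
    hi.add (integrableOn_const (by exact measure_ball_lt_top.ne))
  apply Integrable.mono' h1 hm.aestronglyMeasurable
  refine Eventually.of_forall fun x => ?_
  rw [norm_norm]
  nlinarith [sq_nonneg (‖fderiv ℝ v x‖ - 1)]

lemma cc_strip1 (v : E → ℝ) (hv : Differentiable ℝ v)
    (hz : ∀ x : E, x ∉ ball (0 : E) 1 → v x = 0)
    (hi : IntegrableOn (fun x => ‖fderiv ℝ v x‖ ^ 2) (ball (0 : E) 1))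
    (a b c d : ℝ) (ha : 0 ≤ a) (hab : a < b) (hbc : b ≤ c) (hcd : c < d) :
    4 * π * ((c - b) ^ 2 * volume.real (ball (0 : E) 1 ∩ {x | d ≤ |v x|})) ≤
      (∫ x in ball (0 : E) 1 ∩ {x | a < |v x| ∧ |v x| < d}, ‖fderiv ℝ v x‖) ^ 2 := by
  obtain ⟨φ, k, hk, hφ, hφ0, hφn, hk0, hk1, hks, hφd⟩ := cc_cutoff a b c d ha hab hbc hcd
  have hvc : Continuous v := hv.continuous
  have hi1 := cc_int1 v hi
  have H := cc_sobolev_E v hv hz hi1 φ k hk hφ hφ0 hφn hk0 hk1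
  have hφc : Continuous φ := continuous_iff_continuousAt.2 fun t => (hφ t).continuousAt
  have hm1 : MeasurableSet (ball (0 : E) 1 ∩ {x | d ≤ |v x|}) :=
    measurableSet_ball.inter (measurableSet_le measurable_const hvc.abs.measurable)
  have hm2 : MeasurableSet {x : E | a < |v x| ∧ |v x| < d} :=
    (measurableSet_lt measurable_const hvc.abs.measurable).inter
      (measurableSet_lt hvc.abs.measurable measurable_const)
  have hφi : IntegrableOn (fun x => φ (v x) ^ 2) (ball (0 : E) 1) := by
    have : IntegrableOn (fun x => φ (v x) ^ 2) (closedBall (0 : E) 1) :=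
      (Continuous.continuousOn (by fun_prop)).integrableOn_compact (isCompact_closedBall _ _)
    exact this.mono_set ball_subset_closedBall
  have h1 : (c - b) ^ 2 * volume.real (ball (0 : E) 1 ∩ {x | d ≤ |v x|}) ≤
      ∫ x in ball (0 : E) 1, φ (v x) ^ 2 := by
    calc (c - b) ^ 2 * volume.real (ball (0 : E) 1 ∩ {x | d ≤ |v x|})
        = ∫ x in ball (0 : E) 1 ∩ {x | d ≤ |v x|}, (c - b) ^ 2 := by
          rw [setIntegral_const, smul_eq_mul, mul_comm]
      _ ≤ ∫ x in ball (0 : E) 1 ∩ {x | d ≤ |v x|}, φ (v x) ^ 2 := by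
          apply setIntegral_mono_on _ (hφi.mono_set Set.inter_subset_left) hm1
          · intro x hx
            have := hφd _ hx.2
            have : 0 ≤ c - b := by linarith
            gcongr
          · exact integrableOn_const
              (by exact ((measure_mono Set.inter_subset_left).trans_lt measure_ball_lt_top).ne)
      _ ≤ _ := setIntegral_mono_set hφi (Eventually.of_forall fun x => sq_nonneg _)
          (Eventually.of_forall Set.inter_subset_left)
  have h2 : ∫ x in ball (0 : E) 1, |k (v x)| * ‖fderiv ℝ v x‖ ≤
      ∫ x in ball (0 : E) 1 ∩ {x | a < |v x| ∧ |v x| < d}, ‖fderiv ℝ v x‖ := by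
    rw [← setIntegral_indicator hm2]
    apply integral_mono_of_nonneg
    · exact Eventually.of_forall fun x => by positivity
    · exact hi1.indicator hm2
    · refine Eventually.of_forall fun x => ?_
      simp only
      by_cases hx : x ∈ {x : E | a < |v x| ∧ |v x| < d}
      · rw [Set.indicator_of_mem hx]
        exact mul_le_of_le_one_left (norm_nonneg _) (hk1 _)
      · rw [Set.indicator_of_notMem hx, hks _ hx]; simp
  have h3 : 0 ≤ ∫ x in ball (0 : E) 1, |k (v x)| * ‖fderiv ℝ v x‖ :=
    integral_nonneg fun x => by positivity
  calc _ ≤ 4 * π * ∫ x in ball (0 : E) 1, φ (v x) ^ 2 := by gcongr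
    _ ≤ _ := H
    _ ≤ _ := by gcongr

lemma cc_strip2 (v : E → ℝ) (hv : Differentiable ℝ v)
    (hz : ∀ x : E, x ∉ ball (0 : E) 1 → v x = 0)
    (hi : IntegrableOn (fun x => ‖fderiv ℝ v x‖ ^ 2) (ball (0 : E) 1))
    (a d : ℝ) (ha : 0 ≤ a) (had : a < d) :
    4 * π * ((d - a) ^ 2 * volume.real (ball (0 : E) 1 ∩ {x | d ≤ |v x|})) ≤
      (∫ x in ball (0 : E) 1 ∩ {x | a < |v x| ∧ |v x| < d}, ‖fderiv ℝ v x‖ ^ 2) *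
      (volume.real (ball (0 : E) 1 ∩ {x | a < |v x|}) - volume.real (ball (0 : E) 1 ∩ {x | d ≤ |v x|})) := by
  have hvc : Continuous v := hv.continuous
  have hm1 : MeasurableSet (ball (0 : E) 1 ∩ {x | d ≤ |v x|}) :=
    measurableSet_ball.inter (measurableSet_le measurable_const hvc.abs.measurable)
  have hm3 : MeasurableSet (ball (0 : E) 1 ∩ {x : E | a < |v x| ∧ |v x| < d}) :=
    measurableSet_ball.inter ((measurableSet_lt measurable_const hvc.abs.measurable).inter
      (measurableSet_lt hvc.abs.measurable measurable_const))
  have hfin : ∀ s : Set E, volume (ball (0 : E) 1 ∩ s) ≠ ⊤ := fun s =>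
    ((measure_mono Set.inter_subset_left).trans_lt measure_ball_lt_top).ne
  have hstrip : volume.real (ball (0 : E) 1 ∩ {x | a < |v x| ∧ |v x| < d}) =
      volume.real (ball (0 : E) 1 ∩ {x | a < |v x|}) - volume.real (ball (0 : E) 1 ∩ {x | d ≤ |v x|}) := by
    have hu : ball (0 : E) 1 ∩ {x | a < |v x|} = (ball (0 : E) 1 ∩ {x | a < |v x| ∧ |v x| < d}) ∪
      (ball (0 : E) 1 ∩ {x | d ≤ |v x|}) := by
      ext x
      simp only [Set.mem_inter_iff, Set.mem_ofPred_eq, Set.mem_union]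
      constructor
      · rintro ⟨h1, h2⟩
        rcases lt_or_ge (|v x|) d with h | h
        · exact Or.inl ⟨h1, h2, h⟩
        · exact Or.inr ⟨h1, h⟩
      · rintro (⟨h1, h2, _⟩ | ⟨h1, h2⟩)
        · exact ⟨h1, h2⟩
        · exact ⟨h1, by linarith⟩
    rw [hu, measureReal_union _ hm1 (hfin _) (hfin _)]
    · ring
    · rw [Set.disjoint_left]
      rintro x ⟨_, _, h1⟩ ⟨_, h2⟩
      exact absurd h1 (not_lt.2 h2)
  rw [← hstrip]
  set B := ball (0 : E) 1 ∩ {x | a < |v x| ∧ |v x| < d} with hB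
  have : IsFiniteMeasure (volume.restrict B) := ⟨by
    rw [Measure.restrict_apply_univ]; exact (hfin _).lt_top⟩
  have hcs := cc_cs (volume.restrict B) (fun x => ‖fderiv ℝ v x‖)
    ((cc_int1 v hi).mono_set Set.inter_subset_left) (hi.mono_set Set.inter_subset_left)
  rw [measureReal_restrict_apply_univ] at hcs
  refine le_trans ?_ hcs
  set N := volume.real (ball (0 : E) 1 ∩ {x | d ≤ |v x|})
  have hlim : Tendsto (fun η : ℝ => 4 * π * (((d - η) - (a + η)) ^ 2 * N)) (𝓝[>] 0)
      (𝓝 (4 * π * (((d - 0) - (a + 0)) ^ 2 * N))) := by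
    apply tendsto_nhdsWithin_of_tendsto_nhds
    apply Continuous.tendsto (f := fun η : ℝ => 4 * π * (((d - η) - (a + η)) ^ 2 * N))
    fun_prop
  simp only [sub_zero, add_zero] at hlim
  apply le_of_tendsto hlim
  have : Set.Ioo (0 : ℝ) ((d - a) / 2) ∈ 𝓝[>] (0 : ℝ) := Ioo_mem_nhdsGT (by linarith)
  filter_upwards [this] with η hη
  exact cc_strip1 v hv hz hi a (a + η) (d - η) d ha (by linarith [hη.1]) (by linarith [hη.2])
    (by linarith [hη.1])



lemma cc_ballvol : volume.real (ball (0 : E) 1) = π := by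
  rw [measureReal_def, EuclideanSpace.volume_ball_fin_two]
  simp [Real.pi_pos.le]

lemma cc_rearr (v : E → ℝ) (hv : Differentiable ℝ v)
    (hz : ∀ x : E, x ∉ ball (0 : E) 1 → v x = 0)
    (hi : IntegrableOn (fun x => ‖fderiv ℝ v x‖ ^ 2) (ball (0 : E) 1))
    (he : ∫ x in ball (0 : E) 1, ‖fderiv ℝ v x‖ ^ 2 = 1) :
    ∃ w F : ℝ → ℝ, Monotone w ∧ w 0 = 0 ∧ Monotone F ∧ (∀ t, 0 ≤ F t) ∧ (∀ t, F t ≤ 1) ∧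
      (∀ s t, s ≤ t → 4 * π * (w t - w s) ^ 2 ≤ (F t - F s) * (rexp (t - s) - 1)) ∧
      (∀ τ t, 0 ≤ τ → volume.real (ball (0 : E) 1 ∩ {x | τ < |v x|}) ≤ π * rexp (-t) → w t ≤ τ) ∧
      (∀ τ t, w t < τ → volume.real (ball (0 : E) 1 ∩ {x | τ < |v x|}) ≤ π * rexp (-t)) ∧
      (∀ t, 0 ≤ w t) := by
  have hvc : Continuous v := hv.continuous
  have hfin : ∀ s : Set E, volume (ball (0 : E) 1 ∩ s) ≠ ⊤ := fun s =>
    ((measure_mono Set.inter_subset_left).trans_lt measure_ball_lt_top).ne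
  set V : ℝ → ℝ := fun τ => volume.real (ball (0 : E) 1 ∩ {x | τ < |v x|}) with hV
  have hVa : Antitone V := by
    intro a b hab
    apply measureReal_mono _ (hfin _)
    rintro x ⟨h1, h2⟩
    exact ⟨h1, lt_of_le_of_lt hab h2⟩
  obtain ⟨M, hM⟩ : ∃ M, ∀ x ∈ closedBall (0 : E) 1, ‖v x‖ ≤ M :=
    (isCompact_closedBall _ _).exists_bound_of_continuousOn hvc.continuousOn
  have hM0 : 0 ≤ M := (norm_nonneg _).trans (hM 0 (by simp))
  have hVM : V M = 0 := by
    have : ball (0 : E) 1 ∩ {x | M < |v x|} = ∅ := by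
      ext x
      constructor
      · rintro ⟨h1, h2⟩
        have := hM x (ball_subset_closedBall h1)
        rw [Real.norm_eq_abs] at this
        exact absurd h2 (not_lt.2 this)
      · rintro ⟨⟩
    simp [hV, this]
  set S : ℝ → Set ℝ := fun t => {s | 0 ≤ s ∧ V s ≤ π * rexp (-t)} with hS
  have hSM : ∀ t, M ∈ S t := fun t => ⟨hM0, by rw [hVM]; positivity⟩
  have hSb : ∀ t, BddBelow (S t) := fun t => ⟨0, fun s hs => hs.1⟩
  set w : ℝ → ℝ := fun t => sInf (S t) with hw
  have hw0 : ∀ t, 0 ≤ w t := fun t => le_csInf ⟨M, hSM t⟩ fun s hs => hs.1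
  have hA : ∀ τ t, w t < τ → V τ ≤ π * rexp (-t) := by
    intro τ t h
    obtain ⟨s, hs, hs2⟩ := exists_lt_of_csInf_lt ⟨M, hSM t⟩ h
    exact (hVa hs2.le).trans hs.2
  have hB : ∀ τ t, 0 ≤ τ → V τ ≤ π * rexp (-t) → w t ≤ τ := fun τ t h1 h2 =>
    csInf_le (hSb t) ⟨h1, h2⟩
  have hwm : Monotone w := by
    intro s t hst
    apply csInf_le_csInf (hSb s) ⟨M, hSM t⟩
    rintro x ⟨h1, h2⟩
    refine ⟨h1, h2.trans ?_⟩
    gcongr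
  set F : ℝ → ℝ := fun t => ∫ x in ball (0 : E) 1 ∩ {x | |v x| < w t}, ‖fderiv ℝ v x‖ ^ 2 with hFdef
  have hnn : ∀ s : Set E, 0 ≤ᵐ[volume.restrict s] fun x => ‖fderiv ℝ v x‖ ^ 2 := fun s =>
    Eventually.of_forall fun x => sq_nonneg _
  have hFm : Monotone F := by
    intro s t hst
    apply setIntegral_mono_set (hi.mono_set Set.inter_subset_left) (hnn _)
    refine Eventually.of_forall ?_
    rintro x ⟨h1, h2⟩
    exact ⟨h1, lt_of_lt_of_le h2 (hwm hst)⟩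
  refine ⟨w, F, hwm, ?_, hFm, fun t => integral_nonneg fun x => sq_nonneg _, ?_, ?_, hB, hA, hw0⟩
  · apply le_antisymm _ (hw0 0)
    apply hB 0 0 le_rfl
    rw [neg_zero, Real.exp_zero, mul_one, ← cc_ballvol]
    exact measureReal_mono Set.inter_subset_left measure_ball_lt_top.ne
  · intro t
    rw [← he]
    exact setIntegral_mono_set hi (hnn _) (Eventually.of_forall Set.inter_subset_left)
  · intro s t hst
    have hΔ : 0 ≤ F t - F s := sub_nonneg.2 (hFm hst)
    have hex : 0 ≤ rexp (t - s) - 1 := by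
      have := Real.one_le_exp (show 0 ≤ t - s by linarith)
      linarith
    rcases (hwm hst).eq_or_lt with h | h
    · rw [h]; simp only [sub_self]
      have := mul_nonneg hΔ hex
      simpa using this
    have key : ∀ a d, w s < a → a < d → d < w t →
        4 * π * (d - a) ^ 2 ≤ (F t - F s) * (rexp (t - s) - 1) := by
      intro a d hsa had hdt
      have ha0 : 0 ≤ a := (hw0 s).trans hsa.le
      have H := cc_strip2 v hv hz hi a d ha0 had
      have hm3 : MeasurableSet (ball (0 : E) 1 ∩ {x : E | a < |v x| ∧ |v x| < d}) :=
        measurableSet_ball.inter ((measurableSet_lt measurable_const hvc.abs.measurable).inter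
          (measurableSet_lt hvc.abs.measurable measurable_const))
      have hD : F s + ∫ x in ball (0 : E) 1 ∩ {x | a < |v x| ∧ |v x| < d}, ‖fderiv ℝ v x‖ ^ 2 ≤ F t := by
        rw [hFdef]
        simp only
        rw [← setIntegral_union _ hm3 (hi.mono_set Set.inter_subset_left)
          (hi.mono_set Set.inter_subset_left)]
        · apply setIntegral_mono_set (hi.mono_set Set.inter_subset_left) (hnn _)
          refine Eventually.of_forall ?_
          rintro x (⟨h1, h2⟩ | ⟨h1, h2, h3⟩)
          · exact ⟨h1, lt_trans h2 h⟩
          · exact ⟨h1, lt_trans h3 hdt⟩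
        · rw [Set.disjoint_left]
          rintro x ⟨_, h1⟩ ⟨_, h2, _⟩
          exact absurd (lt_trans h1 hsa) (not_lt.2 h2.le)
      have hV1 : V a ≤ π * rexp (-s) := hA a s hsa
      have hV2 : π * rexp (-t) < V d := by
        by_contra hc
        exact absurd (hB d t (ha0.trans had.le) (not_lt.1 hc)) (not_le.2 hdt)
      have hN1 : V d ≤ volume.real (ball (0 : E) 1 ∩ {x | d ≤ |v x|}) := by
        apply measureReal_mono _ (hfin _)
        rintro x ⟨h1, h2⟩
        have h3 : d < |v x| := h2
        exact ⟨h1, h3.le⟩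
      have hN2 : volume.real (ball (0 : E) 1 ∩ {x | d ≤ |v x|}) ≤ V a := by
        apply measureReal_mono _ (hfin _)
        rintro x ⟨h1, h2⟩
        exact ⟨h1, lt_of_lt_of_le had h2⟩
      change _ ≤ _ * (V a - _) at H
      set N := volume.real (ball (0 : E) 1 ∩ {x | d ≤ |v x|})
      set D := ∫ x in ball (0 : E) 1 ∩ {x | a < |v x| ∧ |v x| < d}, ‖fderiv ℝ v x‖ ^ 2
      have e1 : π * rexp (-s) = (π * rexp (-t)) * rexp (t - s) := by
        rw [mul_assoc, ← Real.exp_add]; ring_nf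
      have hBp : 0 < π * rexp (-t) := by positivity
      set B := π * rexp (-t)
      have h5 : D * (V a - N) ≤ (F t - F s) * (B * rexp (t - s) - N) := by
        apply mul_le_mul _ _ (by linarith) hΔ <;> linarith
      have h6 : 0 ≤ 4 * π * (d - a) ^ 2 := by positivity
      have h7 : (4 * π * (d - a) ^ 2 + (F t - F s)) * B ≤ ((F t - F s) * rexp (t - s)) * B := by
        have : (4 * π * (d - a) ^ 2 + (F t - F s)) * B ≤ (4 * π * (d - a) ^ 2 + (F t - F s)) * N :=
          mul_le_mul_of_nonneg_left (by linarith) (by linarith)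
        nlinarith
      have h8 := le_of_mul_le_mul_right h7 hBp
      linarith
    have hlim : Tendsto (fun η : ℝ => 4 * π * ((w t - η) - (w s + η)) ^ 2) (𝓝[>] 0)
        (𝓝 (4 * π * ((w t - 0) - (w s + 0)) ^ 2)) := by
      apply tendsto_nhdsWithin_of_tendsto_nhds
      apply Continuous.tendsto (f := fun η : ℝ => 4 * π * ((w t - η) - (w s + η)) ^ 2)
      fun_prop
    simp only [sub_zero, add_zero] at hlim
    apply le_of_tendsto hlim
    have : Set.Ioo (0 : ℝ) ((w t - w s) / 2) ∈ 𝓝[>] (0 : ℝ) := Ioo_mem_nhdsGT (by linarith)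
    filter_upwards [this] with η hη
    exact key _ _ (by linarith [hη.1]) (by linarith [hη.2]) (by linarith [hη.1])

lemma cc_exp_lint (c : ℝ) :
    ∫⁻ t in Set.Ioi c, ENNReal.ofReal (π * rexp (-t)) = ENNReal.ofReal (π * rexp (-c)) := by
  rw [← ofReal_integral_eq_lintegral_ofReal]
  · rw [integral_const_mul, integral_exp_neg_Ioi]
  · exact (integrableOn_exp_neg_Ioi c).const_mul π
  · exact Eventually.of_forall fun x => by positivity

lemma cc_prim (u : ℝ) : ∫ t in (0 : ℝ)..u, 8 * π * t * rexp (4 * π * t ^ 2) = rexp (4 * π * u ^ 2) - 1 := by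
  have hd : ∀ t ∈ Set.uIcc 0 u, HasDerivAt (fun t => rexp (4 * π * t ^ 2)) (8 * π * t * rexp (4 * π * t ^ 2)) t := by
    intro t _
    have h := ((hasDerivAt_pow 2 t).const_mul (4 * π)).exp
    refine h.congr_deriv ?_
    push_cast
    ring
  rw [intervalIntegral.integral_eq_sub_of_hasDerivAt hd
    (Continuous.intervalIntegrable (by fun_prop) _ _)]
  simp

lemma cc_equi (v : E → ℝ) (hvc : Continuous v) (w : ℝ → ℝ) (hw : Monotone w) (hw0 : ∀ t, 0 ≤ w t)
    (hA : ∀ τ t, w t < τ → volume.real (ball (0 : E) 1 ∩ {x | τ < |v x|}) ≤ π * rexp (-t)) :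
    ∫⁻ x in ball (0 : E) 1, ENNReal.ofReal (rexp (4 * π * (v x) ^ 2) - 1) ≤
      ENNReal.ofReal π * ∫⁻ t in Set.Ioi (0 : ℝ),
        ENNReal.ofReal ((rexp (4 * π * (w t) ^ 2) - 1) * rexp (-t)) := by
  set ν : Measure ℝ := (volume.restrict (Set.Ioi 0)).withDensity (fun t => ENNReal.ofReal (π * rexp (-t)))
    with hν
  set g : ℝ → ℝ := fun t => 8 * π * t * rexp (4 * π * t ^ 2) with hg
  have hgi : ∀ t > 0, IntervalIntegrable g volume 0 t := fun t _ =>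
    Continuous.intervalIntegrable (by fun_prop) _ _
  have hgn : ∀ᵐ t ∂volume.restrict (Set.Ioi (0 : ℝ)), 0 ≤ g t := by
    filter_upwards [ae_restrict_mem measurableSet_Ioi] with t ht
    have : (0 : ℝ) < t := ht
    positivity
  have hfin : ∀ s : Set E, volume (ball (0 : E) 1 ∩ s) ≠ ⊤ := fun s =>
    ((measure_mono Set.inter_subset_left).trans_lt measure_ball_lt_top).ne
  have L1 := lintegral_comp_eq_lintegral_meas_lt_mul (volume.restrict (ball (0 : E) 1))
    (f := fun x => |v x|) (g := g) (Eventually.of_forall fun x => abs_nonneg _)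
    hvc.abs.measurable.aemeasurable hgi hgn
  have L2 := lintegral_comp_eq_lintegral_meas_le_mul ν
    (f := w) (g := g) (Eventually.of_forall hw0) hw.measurable.aemeasurable hgi hgn
  have e1 : ∀ u, ∫ t in (0 : ℝ)..u, g t = rexp (4 * π * u ^ 2) - 1 := cc_prim
  simp only [e1, sq_abs] at L1 L2
  rw [L1]
  have e2 : ENNReal.ofReal π * ∫⁻ t in Set.Ioi (0 : ℝ),
        ENNReal.ofReal ((rexp (4 * π * (w t) ^ 2) - 1) * rexp (-t)) =
      ∫⁻ t, ENNReal.ofReal (rexp (4 * π * (w t) ^ 2) - 1) ∂ν := by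
    have hwm := hw.measurable
    rw [hν, lintegral_withDensity_eq_lintegral_mul _ (by fun_prop) (by fun_prop),
      ← lintegral_const_mul _ (by fun_prop)]
    apply lintegral_congr
    intro t
    have h1 : 0 ≤ rexp (4 * π * (w t) ^ 2) - 1 := by
      have := Real.one_le_exp (show 0 ≤ 4 * π * (w t) ^ 2 by positivity)
      linarith
    rw [Pi.mul_apply, ← ENNReal.ofReal_mul Real.pi_pos.le, ← ENNReal.ofReal_mul (by positivity)]
    congr 1; ring
  rw [e2, L2]
  apply lintegral_mono_ae
  filter_upwards [ae_restrict_mem measurableSet_Ioi] with τ hτ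
  have hτ0 : (0 : ℝ) < τ := hτ
  gcongr
  rw [Measure.restrict_apply (measurableSet_lt measurable_const hvc.abs.measurable), Set.inter_comm]
  set V := volume.real (ball (0 : E) 1 ∩ {x | τ < |v x|}) with hV
  have hVe : volume (ball (0 : E) 1 ∩ {x | τ < |v x|}) = ENNReal.ofReal V := by
    rw [hV, measureReal_def, ENNReal.ofReal_toReal (hfin _)]
  rw [hVe]
  rcases le_or_gt V 0 with h0 | h0
  · rw [ENNReal.ofReal_of_nonpos h0]; exact zero_le
  have hVπ : V ≤ π := by
    rw [← cc_ballvol]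
    exact measureReal_mono Set.inter_subset_left measure_ball_lt_top.ne
  set c := Real.log (π / V) with hc
  have hc0 : 0 ≤ c := Real.log_nonneg ((one_le_div h0).2 hVπ)
  have hce : π * rexp (-c) = V := by
    rw [Real.exp_neg, hc, Real.exp_log (by positivity)]
    field_simp
  have hsub : Set.Ioi c ⊆ {t | τ ≤ w t} := by
    intro t ht
    have ht' : c < t := ht
    by_contra hcon
    have hlt : w t < τ := not_le.1 hcon
    have h1 : V ≤ π * rexp (-t) := hA τ t hlt
    have h2 : π * rexp (-t) < π * rexp (-c) := by gcongr
    linarith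
  calc ENNReal.ofReal V = ν (Set.Ioi c) := by
        rw [hν, withDensity_apply _ measurableSet_Ioi, Measure.restrict_restrict measurableSet_Ioi,
          Set.inter_eq_left.2 (Set.Ioi_subset_Ioi hc0), cc_exp_lint, hce]
    _ ≤ _ := measure_mono hsub

lemma cc_main1 (v : E → ℝ) (hv : Differentiable ℝ v)
    (hz : ∀ x : E, x ∉ ball (0 : E) 1 → v x = 0)
    (hi : IntegrableOn (fun x => ‖fderiv ℝ v x‖ ^ 2) (ball (0 : E) 1))
    (he : ∫ x in ball (0 : E) 1, ‖fderiv ℝ v x‖ ^ 2 = 1)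
    (g T κ : ℝ) (hg : 0 < g) (hg1 : g < 1) (hT : 0 < T) (hκ : 0 ≤ κ)
    (hk : volume.real (ball (0 : E) 1 ∩ {x | κ < |v x|}) ≤ π * rexp (-T)) :
    ∫⁻ x in ball (0 : E) 1, ENNReal.ofReal (rexp (4 * π * (v x) ^ 2) - 1) ≤
      ENNReal.ofReal (π * ((rexp (4 * π * κ ^ 2) - 1) + rexp (-g * T) / g + rexp 1 / (1 - g))) := by
  obtain ⟨w, F, hw, hw0, hF, hF0, hF1, h, hB, hA, hwn⟩ := cc_rearr v hv hz hi he
  have h1 := cc_equi v hv.continuous w hw hwn hA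
  have hwT : w T ≤ κ := hB κ T hκ hk
  have hsq : ∀ x : ℝ, (√(4 * π) * x) ^ 2 = 4 * π * x ^ 2 := by
    intro x
    rw [mul_pow, Real.sq_sqrt (by positivity)]
  have hr := cc_refine (fun t => √(4 * π) * w t) F hF (by
    intro s t hst
    have := h s t hst
    simp only [← mul_sub, hsq]
    exact this)
  have ho := cc_oneD (fun t => √(4 * π) * w t) F hF hF0 hF1
    (hw.const_mul (Real.sqrt_nonneg _)) (by simp [hw0]) hr g T hg hg1 hT
  simp only [hsq] at ho
  refine h1.trans ?_
  rw [ENNReal.ofReal_mul Real.pi_pos.le]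
  gcongr
  refine ho.trans ?_
  have p1 : 0 ≤ rexp (4 * π * κ ^ 2) - 1 := by
    have := Real.one_le_exp (show 0 ≤ 4 * π * κ ^ 2 by positivity)
    linarith
  have p2 : 0 ≤ rexp (-g * T) / g := by positivity
  have p3 : 0 ≤ rexp 1 / (1 - g) := div_nonneg (Real.exp_pos _).le (by linarith)
  rw [ENNReal.ofReal_add (by positivity) p3, ENNReal.ofReal_add p1 p2]
  have := hwn T
  gcongr

lemma cc_l1 (v : E → ℝ)
    (hi : IntegrableOn (fun x => ‖fderiv ℝ v x‖ ^ 2) (ball (0 : E) 1))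
    (he : ∫ x in ball (0 : E) 1, ‖fderiv ℝ v x‖ ^ 2 = 1) (r : ℝ) (hr : 0 < r) :
    ∫ x in ball (0 : E) 1, ‖fderiv ℝ v x‖ ≤
      π * r / 2 + r / 2 + π * r / 2 + (∫ x in ball (0 : E) 1, ‖x‖ * ‖fderiv ℝ v x‖ ^ 2) / (2 * r ^ 2) := by
  have hB : volume (ball (0 : E) r) ≠ ⊤ := measure_ball_lt_top.ne
  have i1 : IntegrableOn (fun x => (ball (0 : E) r).indicator (fun _ => 1 / (2 * r)) x) (ball (0 : E) 1) :=
    (((integrableOn_const (C := (1 / (2 * r))) (by exact hB)).integrable_indicator measurableSet_ball)).integrableOn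
  have i2 : IntegrableOn (fun x => r / 2 * ‖fderiv ℝ v x‖ ^ 2) (ball (0 : E) 1) := hi.const_mul _
  have i3 : IntegrableOn (fun _ : E => r / 2) (ball (0 : E) 1) :=
    integrableOn_const (by exact measure_ball_lt_top.ne)
  have i4' : IntegrableOn (fun x => ‖x‖ * ‖fderiv ℝ v x‖ ^ 2) (ball (0 : E) 1) := by
    apply Integrable.mono' hi
    · exact (measurable_norm.mul ((measurable_fderiv ℝ v).norm.pow_const 2)).aestronglyMeasurable
    · filter_upwards [ae_restrict_mem measurableSet_ball] with x hx
      rw [mem_ball_zero_iff] at hx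
      rw [Real.norm_of_nonneg (by positivity)]
      exact mul_le_of_le_one_left (sq_nonneg _) hx.le
  have i4 : IntegrableOn (fun x => ‖x‖ * ‖fderiv ℝ v x‖ ^ 2 / (2 * r ^ 2)) (ball (0 : E) 1) :=
    i4'.div_const _
  have i12 : IntegrableOn (fun x => (ball (0 : E) r).indicator (fun _ => 1 / (2 * r)) x
      + r / 2 * ‖fderiv ℝ v x‖ ^ 2) (ball (0 : E) 1) := i1.add i2
  have i123 : IntegrableOn (fun x => (ball (0 : E) r).indicator (fun _ => 1 / (2 * r)) x
      + r / 2 * ‖fderiv ℝ v x‖ ^ 2 + r / 2) (ball (0 : E) 1) := i12.add i3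
  have i1234 : IntegrableOn (fun x => (ball (0 : E) r).indicator (fun _ => 1 / (2 * r)) x
      + r / 2 * ‖fderiv ℝ v x‖ ^ 2 + r / 2 + ‖x‖ * ‖fderiv ℝ v x‖ ^ 2 / (2 * r ^ 2)) (ball (0 : E) 1) := i123.add i4
  have hle : ∫ x in ball (0 : E) 1, ‖fderiv ℝ v x‖ ≤ ∫ x in ball (0 : E) 1,
      ((ball (0 : E) r).indicator (fun _ => 1 / (2 * r)) x
      + r / 2 * ‖fderiv ℝ v x‖ ^ 2 + r / 2 + ‖x‖ * ‖fderiv ℝ v x‖ ^ 2 / (2 * r ^ 2)) := by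
    apply integral_mono (cc_int1 v hi) i1234
    intro x
    simp only
    set y := ‖fderiv ℝ v x‖
    have hy : 0 ≤ y := norm_nonneg _
    by_cases hx : x ∈ ball (0 : E) r
    · rw [Set.indicator_of_mem hx]
      have h1 : y ≤ 1 / (2 * r) + r / 2 * y ^ 2 := by
        have : 1 / (2 * r) + r / 2 * y ^ 2 - y = (r * y - 1) ^ 2 / (2 * r) := by
          field_simp; ring
        have : 0 ≤ (r * y - 1) ^ 2 / (2 * r) := by positivity
        linarith
      have h2 : 0 ≤ r / 2 + ‖x‖ * y ^ 2 / (2 * r ^ 2) := by positivity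
      linarith
    · rw [Set.indicator_of_notMem hx]
      have hx' : r ≤ ‖x‖ := by
        rw [mem_ball_zero_iff] at hx; exact not_lt.1 hx
      have h1 : y ≤ r / 2 + r * y ^ 2 / (2 * r ^ 2) := by
        have : r / 2 + r * y ^ 2 / (2 * r ^ 2) - y = (r - y) ^ 2 / (2 * r) := by
          field_simp; ring
        have : 0 ≤ (r - y) ^ 2 / (2 * r) := by positivity
        linarith
      have h2 : r * y ^ 2 / (2 * r ^ 2) ≤ ‖x‖ * y ^ 2 / (2 * r ^ 2) := by gcongr
      have h3 : 0 ≤ r / 2 * y ^ 2 := by positivity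
      linarith
  refine hle.trans ?_
  rw [integral_add i123 i4, integral_add i12 i3, integral_add i1 i2, integral_const_mul, he,
    show ∫ x in ball (0 : E) 1, ‖x‖ * ‖fderiv ℝ v x‖ ^ 2 / (2 * r ^ 2) =
      (∫ x in ball (0 : E) 1, ‖x‖ * ‖fderiv ℝ v x‖ ^ 2) / (2 * r ^ 2) from integral_div _ _,
    setIntegral_const, cc_ballvol]
  have hb : ∫ x in ball (0 : E) 1, (ball (0 : E) r).indicator (fun _ => 1 / (2 * r)) x ≤ π * r / 2 := by
    rw [setIntegral_indicator measurableSet_ball, setIntegral_const, smul_eq_mul]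
    have : volume.real (ball (0 : E) 1 ∩ ball (0 : E) r) ≤ r ^ 2 * π := by
      have h1 : volume.real (ball (0 : E) r) = r ^ 2 * π := by
        rw [measureReal_def, EuclideanSpace.volume_ball_fin_two]
        simp [Real.pi_pos.le, hr.le]
      rw [← h1]
      exact measureReal_mono Set.inter_subset_right hB
    calc _ ≤ r ^ 2 * π * (1 / (2 * r)) := by gcongr
      _ = _ := by field_simp
  rw [smul_eq_mul]
  linarith

lemma cc_vol (v : E → ℝ) (hv : Differentiable ℝ v)
    (hz : ∀ x : E, x ∉ ball (0 : E) 1 → v x = 0)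
    (hi : IntegrableOn (fun x => ‖fderiv ℝ v x‖ ^ 2) (ball (0 : E) 1))
    (κ p : ℝ) (hκ : 0 < κ)
    (hI : (∫ x in ball (0 : E) 1, ‖fderiv ℝ v x‖) ^ 2 ≤ 4 * π * ((κ / 3) ^ 2 * p)) :
    volume.real (ball (0 : E) 1 ∩ {x | κ < |v x|}) ≤ p := by
  have H := cc_strip1 v hv hz hi 0 (κ / 3) (2 * κ / 3) κ le_rfl (by linarith) (by linarith) (by linarith)
  have h1 : ∫ x in ball (0 : E) 1 ∩ {x | 0 < |v x| ∧ |v x| < κ}, ‖fderiv ℝ v x‖ ≤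
      ∫ x in ball (0 : E) 1, ‖fderiv ℝ v x‖ :=
    setIntegral_mono_set (cc_int1 v hi) (Eventually.of_forall fun x => norm_nonneg _)
      (Eventually.of_forall Set.inter_subset_left)
  have h0 : 0 ≤ ∫ x in ball (0 : E) 1 ∩ {x | 0 < |v x| ∧ |v x| < κ}, ‖fderiv ℝ v x‖ :=
    integral_nonneg fun x => norm_nonneg _
  have h2 := pow_le_pow_left₀ h0 h1 2
  have e : 2 * κ / 3 - κ / 3 = κ / 3 := by ring
  rw [e] at H
  have h3 := (H.trans h2).trans hI
  have h4 := le_of_mul_le_mul_left h3 (by positivity)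
  have h5 := le_of_mul_le_mul_left h4 (by positivity)
  refine le_trans ?_ h5
  apply measureReal_mono
  · rintro x ⟨h6, h7⟩
    have h8 : κ < |v x| := h7
    exact ⟨h6, h8.le⟩
  · exact ((measure_mono Set.inter_subset_left).trans_lt measure_ball_lt_top).ne


/-- Carleson–Chang: if `{v_ε}_{ε>0} ⊂ W₀^{1,2}(𝔹)` satisfies
`∫_𝔹 |∇v_ε|² dx = 1` and `|∇v_ε|² dx ⇀ δ₀` weakly as `ε → 0`, then
`limsup_{ε→0} ∫_𝔹 (e^{4π v_ε²} − 1) dx ≤ π e`. -/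
theorem carleson_chang
    (v : ℝ → E → ℝ)
    (hdiff : ∀ ε : ℝ, 0 < ε → Differentiable ℝ (v ε))
    (hzero : ∀ ε : ℝ, 0 < ε → ∀ x : E, x ∉ ball (0 : E) 1 → v ε x = 0)
    (henergy : ∀ ε : ℝ, 0 < ε →
      ∫ x in ball (0 : E) 1, ‖fderiv ℝ (v ε) x‖ ^ 2 = 1)
    (hweak : ∀ f : E → ℝ, Continuous f →
      Tendsto (fun ε : ℝ => ∫ x in ball (0 : E) 1, f x * ‖fderiv ℝ (v ε) x‖ ^ 2)
        (𝓝[>] 0) (𝓝 (f 0))) :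
    limsup
        (fun ε : ℝ =>
          ∫⁻ x in ball (0 : E) 1,
            ENNReal.ofReal (Real.exp (4 * π * (v ε x) ^ 2) - 1))
        (𝓝[>] 0) ≤ ENNReal.ofReal (π * Real.exp 1) := by
  have hmain : ∀ δ : ℝ, 0 < δ → limsup
        (fun ε : ℝ =>
          ∫⁻ x in ball (0 : E) 1,
            ENNReal.ofReal (Real.exp (4 * π * (v ε x) ^ 2) - 1))
        (𝓝[>] 0) ≤ ENNReal.ofReal (π * (δ + δ + (rexp 1 + δ))) := by
    intro δ hδ
    have hexp : 0 < rexp 1 := Real.exp_pos 1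
    obtain ⟨g, hg, hg1, hge⟩ : ∃ g : ℝ, 0 < g ∧ g < 1 ∧ rexp 1 / (1 - g) = rexp 1 + δ := by
      refine ⟨δ / (rexp 1 + δ), by positivity, ?_, ?_⟩
      · rw [div_lt_one (by positivity)]; linarith
      · have : 1 - δ / (rexp 1 + δ) = rexp 1 / (rexp 1 + δ) := by field_simp; ring
        rw [this]; field_simp
    obtain ⟨T, hT, hTe⟩ : ∃ T : ℝ, 0 < T ∧ rexp (-g * T) / g ≤ δ := by
      refine ⟨1 / (g * (g * δ)), by positivity, ?_⟩
      rw [div_le_iff₀ hg]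
      have h1 : -g * (1 / (g * (g * δ))) = -(1 / (g * δ)) := by field_simp
      rw [h1, Real.exp_neg]
      have h2 : 1 / (g * δ) ≤ rexp (1 / (g * δ)) := by
        have := Real.add_one_le_exp (1 / (g * δ)); linarith
      calc (rexp (1 / (g * δ)))⁻¹ ≤ (1 / (g * δ))⁻¹ := by gcongr
        _ = δ * g := by field_simp
    obtain ⟨κ, hκ, hκe⟩ : ∃ κ : ℝ, 0 < κ ∧ rexp (4 * π * κ ^ 2) - 1 = δ := by
      have hl : 0 < Real.log (1 + δ) := Real.log_pos (by linarith)
      refine ⟨√(Real.log (1 + δ) / (4 * π)), by positivity, ?_⟩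
      rw [Real.sq_sqrt (by positivity), mul_div_cancel₀ _ (by positivity), Real.exp_log (by linarith)]
      ring
    set θ := √(4 * π * ((κ / 3) ^ 2 * (π * rexp (-T)))) with hθ
    have hθ0 : 0 < θ := by positivity
    have hθ2 : θ ^ 2 = 4 * π * ((κ / 3) ^ 2 * (π * rexp (-T))) := Real.sq_sqrt (by positivity)
    set r := θ / (2 * (π + 1)) with hr
    have hr0 : 0 < r := by positivity
    have hlim := hweak (fun x => ‖x‖) continuous_norm
    rw [norm_zero] at hlim
    have hev : ∀ᶠ ε in 𝓝[>] (0 : ℝ),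
        ∫ x in ball (0 : E) 1, ‖x‖ * ‖fderiv ℝ (v ε) x‖ ^ 2 < r ^ 2 * θ :=
      hlim.eventually_lt_const (by positivity)
    apply limsup_le_of_le
    · isBoundedDefault
    filter_upwards [hev, self_mem_nhdsWithin] with ε hε hε0
    have hpos : 0 < ε := hε0
    have he := henergy ε hpos
    have hi : IntegrableOn (fun x => ‖fderiv ℝ (v ε) x‖ ^ 2) (ball (0 : E) 1) := by
      by_contra hcon
      rw [integral_undef hcon] at he
      exact zero_ne_one he
    have hL := cc_l1 (v ε) hi he r hr0
    have hLθ : ∫ x in ball (0 : E) 1, ‖fderiv ℝ (v ε) x‖ ≤ θ := by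
      refine hL.trans ?_
      have h1 : (∫ x in ball (0 : E) 1, ‖x‖ * ‖fderiv ℝ (v ε) x‖ ^ 2) / (2 * r ^ 2) ≤ θ / 2 := by
        rw [div_le_iff₀ (by positivity)]
        nlinarith
      have h2 : (π + 1) * r = θ / 2 := by rw [hr]; field_simp
      linarith
    have h0 : 0 ≤ ∫ x in ball (0 : E) 1, ‖fderiv ℝ (v ε) x‖ := integral_nonneg fun x => norm_nonneg _
    have hk := cc_vol (v ε) (hdiff ε hpos) (hzero ε hpos) hi κ (π * rexp (-T)) hκ (by
      rw [← hθ2]; exact pow_le_pow_left₀ h0 hLθ 2)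
    refine (cc_main1 (v ε) (hdiff ε hpos) (hzero ε hpos) hi he g T κ hg hg1 hT hκ.le hk).trans ?_
    apply ENNReal.ofReal_le_ofReal
    rw [hge, hκe]
    gcongr
  have hl : Tendsto (fun δ : ℝ => ENNReal.ofReal (π * (δ + δ + (rexp 1 + δ)))) (𝓝[>] 0)
      (𝓝 (ENNReal.ofReal (π * (0 + 0 + (rexp 1 + 0))))) := by
    apply tendsto_nhdsWithin_of_tendsto_nhds
    apply ENNReal.tendsto_ofReal
    apply Continuous.tendsto (f := fun δ : ℝ => π * (δ + δ + (rexp 1 + δ)))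
    fun_prop
  simp only [zero_add, add_zero] at hl
  apply ge_of_tendsto hl
  filter_upwards [self_mem_nhdsWithin] with δ hδ
  exact hmain δ hδ
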